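/- arXiv:2012.10370 — 3 statements merged into one kernel-verified Lean document; each statement's English description precedes it below -/
import Mathlib

section
/- Let μ ∈ P₂(ℝ^d) and N ≥ 1. A probability measure ν ∈ P(ℝ^d,N) with ν ≤_cvx μ is a W₂-projection of μ onto the set P_{≤μ}(ℝ^d,N) of measures supported on at most N points that are dominated by μ in the convex order if and only if ∫|x|² ν(dx) = sup over η ∈ P_{≤μ}(ℝ^d,N) of ∫|x|² η(dx). Moreover, in that case W₂(ν,μ) = M₂(ν,μ). -/
open MeasureTheory Set

noncomputable section

abbrev Ed (d : ℕ) := EuclideanSpace ℝ (Fin d)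

variable {E : Type*} [NormedAddCommGroup E] [NormedSpace ℝ E] [MeasurableSpace E] [BorelSpace E]

/-- A coupling between `μ` and `ν`. -/
def IsCoupling (π : Measure (E × E)) (μ ν : Measure E) : Prop :=
  π.map Prod.fst = μ ∧ π.map Prod.snd = ν

/-- A martingale coupling between `μ` and `ν` : a probability coupling such that the
conditional expectation of the second coordinate given the first is the first. -/
def IsMartingaleCoupling (π : Measure (E × E)) (μ ν : Measure E) : Prop :=
  IsProbabilityMeasure π ∧ IsCoupling π μ ν ∧
    ∀ A : Set E, MeasurableSet A →
      ∫ q in A ×ˢ (univ : Set E), (q.2 - q.1) ∂π = 0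

/-- The convex order `μ ≤_cvx ν`. -/
def ConvexOrder (μ ν : Measure E) : Prop :=
  ∀ φ : E → ℝ, ConvexOn ℝ univ φ → Integrable φ μ → Integrable φ ν →
    ∫ x, φ x ∂μ ≤ ∫ x, φ x ∂ν

/-- The `p`-th power transport cost of a coupling. -/
def pCost (p : ℝ) (π : Measure (E × E)) : ℝ := ∫ q, ‖q.2 - q.1‖ ^ p ∂π

/-- `W_p(μ,ν)^p`. -/
def WpPow (p : ℝ) (μ ν : Measure E) : ℝ :=
  sInf {c | ∃ π : Measure (E × E), IsProbabilityMeasure π ∧ IsCoupling π μ ν ∧ c = pCost p π}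

/-- The Wasserstein distance `W_p(μ,ν)`. -/
def Wp (p : ℝ) (μ ν : Measure E) : ℝ := WpPow p μ ν ^ (1 / p)

/-- `M_p(μ,ν)^p` : the martingale transport cost. -/
def MpPow (p : ℝ) (μ ν : Measure E) : ℝ :=
  sInf {c | ∃ π : Measure (E × E), IsMartingaleCoupling π μ ν ∧ c = pCost p π}

/-- `M_p(μ,ν)`. -/
def Mp (p : ℝ) (μ ν : Measure E) : ℝ := MpPow p μ ν ^ (1 / p)

/-- A Borel nearest-neighbour projection onto the finite set `Γ`. -/
def IsNearestProj (Γ : Finset E) (f : E → E) : Prop :=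
  Measurable f ∧ ∀ x, f x ∈ Γ ∧ ‖x - f x‖ = Metric.infDist x (Γ : Set E)

/-- `e_p(Γ,μ)^p`, the `p`-th power quantization error on the grid `Γ`. -/
def quantErrPow (p : ℝ) (Γ : Finset E) (μ : Measure E) : ℝ :=
  ∫ x, Metric.infDist x (Γ : Set E) ^ p ∂μ

/-- `Γ` is an `L^p`-optimal `N`-quantizer of `μ`. -/
def IsOptimalQuantizer (p : ℝ) (N : ℕ) (Γ : Finset E) (μ : Measure E) : Prop :=
  Γ.Nonempty ∧ Γ.card ≤ N ∧
    ∀ Γ' : Finset E, Γ'.Nonempty → Γ'.card ≤ N → quantErrPow p Γ μ ≤ quantErrPow p Γ' μ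

/-- `ν` is supported on at most `N` points. -/
def SuppLE (N : ℕ) (ν : Measure E) : Prop :=
  ∃ s : Finset E, s.card ≤ N ∧ ν ((s : Set E)ᶜ) = 0


set_option maxHeartbeats 1600000 in
/-- Finite-dimensional moment problem for fuzzy partitions. -/
theorem exists_fuzzy {Ω ι κ : Type*} [MeasurableSpace Ω] (μ : Measure Ω) [IsProbabilityMeasure μ]
    [Fintype ι] [Nonempty ι] [Fintype κ] (g : κ → Ω → ℝ) (hgm : ∀ k, Measurable (g k))
    (hg : ∀ k, MemLp (g k) 2 μ)
    (P : ι → κ → ℝ)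
    (hP : ∀ c : ι → κ → ℝ, ∑ i, ∑ k, c i k * P i k ≤
      ∫ y, Finset.univ.sup' Finset.univ_nonempty (fun i => ∑ k, c i k * g k y) ∂μ) :
    ∃ f : ι → Ω → ℝ, (∀ i, Measurable (f i)) ∧ (∀ i, MemLp (f i) 2 μ) ∧ (∀ i, ∀ᵐ y ∂μ, 0 ≤ f i y) ∧
      (∀ᵐ y ∂μ, ∑ i, f i y = 1) ∧ ∀ i k, ∫ y, f i y * g k y ∂μ = P i k := by
  classical
  let G : κ → Lp ℝ 2 μ := fun k => (hg k).toLp (g k)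
  let C : Set (ι → WeakDual ℝ (Lp ℝ 2 μ)) :=
    (Set.univ.pi fun _ => WeakDual.toStrongDual ⁻¹' Metric.closedBall 0 1) ∩
      ({φ | ∀ i, ∀ h : Lp ℝ 2 μ, 0 ≤ h → 0 ≤ φ i h} ∩
       {φ | ∀ h : Lp ℝ 2 μ, ∑ i, φ i h = ∫ y, h y ∂μ})
  have hev : ∀ i (h : Lp ℝ 2 μ), Continuous fun φ : ι → WeakDual ℝ (Lp ℝ 2 μ) => φ i h :=
    fun i h => (WeakDual.eval_continuous h).comp (continuous_apply i)
  have hCcomp : IsCompact C := by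
    refine (isCompact_univ_pi fun _ => WeakDual.isCompact_closedBall 0 1).inter_right ?_
    refine IsClosed.inter ?_ ?_
    · simp only [ofPred_forall]
      exact isClosed_iInter fun i => isClosed_iInter fun h => isClosed_iInter fun _ =>
        isClosed_le continuous_const (hev i h)
    · simp only [ofPred_forall]
      exact isClosed_iInter fun h =>
        isClosed_eq (continuous_finsetSum _ fun i _ => hev i h) continuous_const
  have hCconv : Convex ℝ C := by
    refine (convex_pi fun _ _ => ?_).inter (Convex.inter ?_ ?_)
    · exact (convex_closedBall (0 : StrongDual ℝ (Lp ℝ 2 μ)) 1).is_linear_preimage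
        (WeakDual.toStrongDual (𝕜 := ℝ) (E := Lp ℝ 2 μ)).toLinearMap.isLinear
    · intro φ hφ ψ hψ a b ha hb hab i h hh
      have h1 := hφ i h hh
      have h2 := hψ i h hh
      change 0 ≤ a * φ i h + b * ψ i h
      positivity
    · intro φ hφ ψ hψ a b ha hb hab h
      have h1 := hφ h
      have h2 := hψ h
      change ∑ i, (a * φ i h + b * ψ i h) = _
      rw [Finset.sum_add_distrib, ← Finset.mul_sum, ← Finset.mul_sum, h1, h2, ← add_mul, hab, one_mul]
  let T : (ι → WeakDual ℝ (Lp ℝ 2 μ)) →ₗ[ℝ] (ι × κ → ℝ) :=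
    { toFun := fun φ ik => φ ik.1 (G ik.2)
      map_add' := fun _ _ => rfl
      map_smul' := fun _ _ => rfl }
  have hTc : Continuous T := continuous_pi fun ik => hev ik.1 (G ik.2)
  have key : (fun ik : ι × κ => P ik.1 ik.2) ∈ T '' C := by
    by_contra hnot
    obtain ⟨ℓ, u, h1, h2⟩ := geometric_hahn_banach_closed_point (hCconv.linear_image T)
      (hCcomp.image hTc).isClosed hnot
    let c : ι → κ → ℝ := fun i k => ℓ (Pi.single (i, k) 1)
    have hℓ : ∀ v : ι × κ → ℝ, ℓ v = ∑ i, ∑ k, c i k * v (i, k) := by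
      intro v
      conv_lhs => rw [pi_eq_sum_univ' v]
      rw [map_sum, Fintype.sum_prod_type]
      simp only [map_smul, smul_eq_mul]
      refine Finset.sum_congr rfl fun i _ => Finset.sum_congr rfl fun k _ => ?_
      rw [mul_comm]
    let U : ι → Ω → ℝ := fun i y => ∑ k, c i k * g k y
    have hUm : ∀ i, Measurable (U i) := fun i => by
      have := hgm
      fun_prop
    let M : Ω → ℝ := fun y => Finset.univ.sup' Finset.univ_nonempty (fun i => U i y)
    have hMm : Measurable M := by
      have := Finset.measurable_sup' (s := Finset.univ) Finset.univ_nonempty (fun i _ => hUm i)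
      have h0 : M = Finset.univ.sup' Finset.univ_nonempty U := by
        funext y
        exact (Finset.sup'_apply Finset.univ_nonempty U y).symm
      rw [h0]
      exact this
    let χ : ι → Ω → ℝ := fun i => {y | U i y = M y}.indicator 1
    have hχm : ∀ i, Measurable (χ i) := fun i =>
      measurable_one.indicator (measurableSet_eq_fun (hUm i) hMm)
    have hχ0 : ∀ i y, 0 ≤ χ i y := fun i y => Set.indicator_nonneg (fun _ _ => zero_le_one) _
    have hDpos : ∀ y, 0 < ∑ i, χ i y := by
      intro y
      obtain ⟨i, _, hi⟩ := Finset.exists_mem_eq_sup' Finset.univ_nonempty (fun i => U i y)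
      refine Finset.sum_pos' (fun i _ => hχ0 i y) ⟨i, Finset.mem_univ _, ?_⟩
      have : y ∈ {y | U i y = M y} := hi.symm
      simp [χ, Set.indicator_of_mem this]
    let f : ι → Ω → ℝ := fun i y => χ i y / ∑ j, χ j y
    have hfm : ∀ i, Measurable (f i) := fun i =>
      (hχm i).div (Finset.measurable_fun_sum _ fun j _ => hχm j)
    have hf0 : ∀ i y, 0 ≤ f i y := fun i y => div_nonneg (hχ0 i y) (hDpos y).le
    have hfs : ∀ y, ∑ i, f i y = 1 := fun y => by
      simp only [f]
      rw [← Finset.sum_div, div_self (hDpos y).ne']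
    have hf1 : ∀ i y, f i y ≤ 1 := fun i y => by
      rw [← hfs y]
      exact Finset.single_le_sum (f := fun i => f i y) (fun j _ => hf0 j y) (Finset.mem_univ i)
    have hfU : ∀ y, ∑ i, f i y * U i y = M y := by
      intro y
      have : ∀ i, f i y * U i y = f i y * M y := by
        intro i
        by_cases h : U i y = M y
        · rw [h]
        · have : χ i y = 0 := Set.indicator_of_notMem (s := {y | U i y = M y}) h _
          simp [f, this]
      simp_rw [this]
      rw [← Finset.sum_mul, hfs, one_mul]
    have hfL : ∀ i, MemLp (f i) 2 μ := fun i =>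
      MemLp.of_bound (hfm i).aestronglyMeasurable 1 (Filter.Eventually.of_forall fun y => by
        rw [Real.norm_of_nonneg (hf0 i y)]; exact hf1 i y)
    let F : ι → Lp ℝ 2 μ := fun i => (hfL i).toLp (f i)
    let φ : ι → WeakDual ℝ (Lp ℝ 2 μ) := fun i =>
      StrongDual.toWeakDual (InnerProductSpace.toDual ℝ (Lp ℝ 2 μ) (F i))
    have hφ : ∀ i h, φ i h = ∫ y, f i y * h y ∂μ := by
      intro i h
      change inner ℝ (F i) h = _
      rw [L2.inner_def]
      refine integral_congr_ae ?_
      filter_upwards [(hfL i).coeFn_toLp] with y hy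
      have hy' : (F i) y = f i y := hy
      rw [hy', RCLike.inner_apply, conj_trivial, mul_comm]
    have hφC : φ ∈ C := by
      refine ⟨fun i _ => ?_, fun i h hh => ?_, fun h => ?_⟩
      · change InnerProductSpace.toDual ℝ (Lp ℝ 2 μ) (F i) ∈ Metric.closedBall 0 1
        rw [mem_closedBall_zero_iff, LinearIsometryEquiv.norm_map]
        have := Lp.norm_le_of_ae_bound (f := F i) (C := 1) zero_le_one (by
          filter_upwards [(hfL i).coeFn_toLp] with y hy
          simp only [F, hy]
          rw [Real.norm_of_nonneg (hf0 i y)]; exact hf1 i y)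
        have hmu : measureUnivNNReal μ = 1 := by simp [measureUnivNNReal]
        simpa [hmu] using this
      · rw [hφ]
        refine integral_nonneg_of_ae ?_
        filter_upwards [(Lp.coeFn_nonneg h).2 hh] with y hy
        exact mul_nonneg (hf0 i y) hy
      · simp_rw [hφ]
        have hint0 : ∀ i ∈ Finset.univ, Integrable (fun y => f i y * h y) μ :=
          fun i _ => (hfL i).integrable_mul (Lp.memLp h)
        rw [← integral_finsetSum _ hint0]
        simp_rw [← Finset.sum_mul, hfs, one_mul]
    have h3 := h1 _ (Set.mem_image_of_mem T hφC)
    rw [hℓ] at h2 h3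
    have h4 : ∀ i k, T φ (i, k) = ∫ y, f i y * g k y ∂μ := by
      intro i k
      change φ i (G k) = _
      rw [hφ]
      refine integral_congr_ae ?_
      filter_upwards [(hg k).coeFn_toLp] with y hy
      simp only [G, hy]
    simp_rw [h4] at h3
    have h5 : ∑ i, ∑ k, c i k * ∫ y, f i y * g k y ∂μ = ∫ y, M y ∂μ := by
      have hint : ∀ i k, Integrable (fun y => c i k * (f i y * g k y)) μ := fun i k =>
        ((hfL i).integrable_mul (hg k)).const_mul _
      simp_rw [← integral_const_mul]
      have : ∀ i, ∑ k, ∫ y, c i k * (f i y * g k y) ∂μ = ∫ y, f i y * U i y ∂μ := by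
        intro i
        rw [← integral_finsetSum _ fun k _ => hint i k]
        congr 1; ext y
        simp only [U, Finset.mul_sum]
        exact Finset.sum_congr rfl fun k _ => by ring
      simp_rw [this]
      rw [← integral_finsetSum]
      · simp_rw [hfU]
      · intro i _
        have h6 := integrable_finsetSum Finset.univ fun k _ => hint i k
        refine h6.congr (Filter.Eventually.of_forall fun y => ?_)
        simp only [U, Finset.mul_sum]
        exact Finset.sum_congr rfl fun k _ => by ring
    rw [h5] at h3
    have := hP c
    change _ ≤ ∫ y, M y ∂μ at this
    linarith
  obtain ⟨φ, ⟨-, hpos, hsum⟩, hφP⟩ := key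
  let F : ι → Lp ℝ 2 μ := fun i =>
    (InnerProductSpace.toDual ℝ (Lp ℝ 2 μ)).symm (WeakDual.toStrongDual (φ i))
  have hF : ∀ i h, φ i h = ∫ y, F i y * h y ∂μ := by
    intro i h
    have : inner ℝ (F i) h = φ i h := InnerProductSpace.toDual_symm_apply
    rw [← this, L2.inner_def]
    refine integral_congr_ae (Filter.Eventually.of_forall fun y => ?_)
    change inner ℝ (F i y) (h y) = F i y * h y
    rw [RCLike.inner_apply, conj_trivial, mul_comm]
  have hFint : ∀ i, Integrable (F i) μ := fun i => (Lp.memLp (F i)).integrable (by norm_num)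
  have hset : ∀ i {A : Set Ω} (hA : MeasurableSet A),
      φ i (indicatorConstLp 2 hA (measure_ne_top μ A) (1 : ℝ)) = ∫ y in A, F i y ∂μ := by
    intro i A hA
    rw [hF, ← integral_indicator hA]
    refine integral_congr_ae ?_
    filter_upwards [indicatorConstLp_coeFn (p := 2) (hs := hA) (hμs := measure_ne_top μ A) (c := (1:ℝ))] with y hy
    rw [hy]
    by_cases h : y ∈ A <;> simp [h]
  refine ⟨fun i => F i, fun i => (Lp.stronglyMeasurable (F i)).measurable, fun i => Lp.memLp _,
    fun i => ?_, ?_, fun i k => ?_⟩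
  · refine ae_nonneg_of_forall_setIntegral_nonneg (hFint i) fun A hA _ => ?_
    rw [← hset i hA]
    refine hpos i _ ?_
    rw [← Lp.coeFn_nonneg]
    filter_upwards [indicatorConstLp_coeFn (p := 2) (hs := hA) (hμs := measure_ne_top μ A) (c := (1:ℝ))] with y hy
    rw [hy]
    exact Set.indicator_nonneg (fun _ _ => zero_le_one) _
  · refine Integrable.ae_eq_of_forall_setIntegral_eq _ _
      (integrable_finsetSum Finset.univ fun i _ => hFint i) (integrable_const 1) fun A hA _ => ?_
    rw [integral_finsetSum _ fun i _ => (hFint i).integrableOn]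
    simp_rw [← hset _ hA]
    rw [hsum, integral_congr_ae indicatorConstLp_coeFn, integral_indicator hA]
  · have := congrFun hφP (i, k)
    change φ i (G k) = P i k at this
    rw [← this, hF]
    refine integral_congr_ae ?_
    filter_upwards [(hg k).coeFn_toLp] with y hy
    simp only [G, hy]

theorem fin_int {d : ℕ} {F : Type*} [NormedAddCommGroup F] [NormedSpace ℝ F] [CompleteSpace F]
    (ν : Measure (Ed d)) [IsFiniteMeasure ν] (s : Finset (Ed d)) (hs : ν ((s : Set (Ed d))ᶜ) = 0)
    (h : Ed d → F) : Integrable h ν ∧ ∫ x, h x ∂ν = ∑ x ∈ s, ν.real {x} • h x := by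
  have hr : ν.restrict (s : Set (Ed d)) = ν := Measure.restrict_eq_self_of_ae_mem hs
  have hi : IntegrableOn h (s : Set (Ed d)) ν := IntegrableOn.finset
  refine ⟨?_, ?_⟩
  · rw [← hr]; exact hi
  · rw [← setIntegral_finset s hi, hr]

/-- Strassen's theorem for finitely supported measures. -/
theorem strassen_fin {d : ℕ} (μ ν : Measure (Ed d)) [IsProbabilityMeasure μ]
    [IsProbabilityMeasure ν] (hμ : MemLp (fun x : Ed d => x) 2 μ)
    (s : Finset (Ed d)) (hs : ν ((s : Set (Ed d))ᶜ) = 0) (hνμ : ConvexOrder ν μ) :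
    ∃ π : Measure (Ed d × Ed d), IsMartingaleCoupling π ν μ := by
  classical
  have hsne : s.Nonempty := by
    rw [Finset.nonempty_iff_ne_empty]
    rintro rfl
    simp at hs
  have : Nonempty s := hsne.to_subtype
  let g : Option (Fin d) → Ed d → ℝ := fun k y => k.elim 1 (fun j => y j)
  have hgm : ∀ k, Measurable (g k) := by
    rintro (_ | j)
    · exact measurable_const
    · change Measurable fun y : Ed d => y j
      fun_prop
  have hg : ∀ k, MemLp (g k) 2 μ := by
    rintro (_ | j)
    · exact memLp_const 1
    · exact hμ.eval_piLp j
  have hga : ∀ k (x y : Ed d) (a b : ℝ), a + b = 1 → g k (a • x + b • y) = a * g k x + b * g k y := by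
    rintro (_ | j) x y a b hab
    · simp [g, hab]
    · simp [g]
  let P : s → Option (Fin d) → ℝ := fun i k => ν.real {(i : Ed d)} * g k i
  obtain ⟨f, hfm, hfL, hf0, hf1, hfP⟩ := exists_fuzzy μ g hgm hg P (by
    intro c
    let U : s → Ed d → ℝ := fun i y => ∑ k, c i k * g k y
    let φ : Ed d → ℝ := fun y => Finset.univ.sup' Finset.univ_nonempty (fun i => U i y)
    have hUφ : ∀ i y, U i y ≤ φ y := fun i y =>
      Finset.le_sup' (fun i => U i y) (Finset.mem_univ i)
    have hφc : ConvexOn ℝ univ φ := by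
      refine ⟨convex_univ, fun x _ y _ a b ha hb hab => ?_⟩
      refine Finset.sup'_le _ _ fun i _ => ?_
      have : U i (a • x + b • y) = a * U i x + b * U i y := by
        simp only [U, Finset.mul_sum, ← Finset.sum_add_distrib]
        refine Finset.sum_congr rfl fun k _ => ?_
        rw [hga k x y a b hab]; ring
      rw [this]
      exact add_le_add (mul_le_mul_of_nonneg_left (hUφ i x) ha)
        (mul_le_mul_of_nonneg_left (hUφ i y) hb)
    have hφi : Integrable φ μ := by
      have h0 : φ = Finset.univ.sup' Finset.univ_nonempty U := by
        funext y
        exact (Finset.sup'_apply Finset.univ_nonempty U y).symm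
      rw [h0]
      refine Finset.sup'_induction (p := fun u => Integrable u μ) _ _ (fun a ha b hb => ha.sup hb) ?_
      intro i _
      exact integrable_finsetSum _ fun k _ => ((hg k).integrable (by norm_num)).const_mul _
    obtain ⟨h1, h2⟩ := fin_int ν s hs φ
    have h3 := hνμ φ hφc h1 hφi
    refine le_trans ?_ h3
    rw [h2, ← Finset.sum_coe_sort s]
    refine Finset.sum_le_sum fun i _ => ?_
    have : ∑ k, c i k * P i k = ν.real {(i : Ed d)} * U i i := by
      simp only [P, U, Finset.mul_sum]
      exact Finset.sum_congr rfl fun k _ => by ring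
    rw [this]
    exact mul_le_mul_of_nonneg_left (hUφ i i) measureReal_nonneg)
  have hfi : ∀ i, Integrable (f i) μ := fun i => (hfL i).integrable (by norm_num)
  have hfm' : ∀ i, Measurable fun y => ENNReal.ofReal (f i y) := fun i => (hfm i).ennreal_ofReal
  let ρ : s → Measure (Ed d) := fun i => μ.withDensity fun y => ENNReal.ofReal (f i y)
  have hmk : ∀ i : s, Measurable fun y : Ed d => ((i : Ed d), y) := fun i => measurable_prodMk_left
  let π : Measure (Ed d × Ed d) := ∑ i : s, (ρ i).map (fun y => ((i : Ed d), y))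
  have hρ : ∀ i, ρ i univ = ν {(i : Ed d)} := by
    intro i
    simp only [ρ]
    rw [withDensity_apply _ MeasurableSet.univ, Measure.restrict_univ,
      ← ofReal_integral_eq_lintegral_ofReal (hfi i) (hf0 i)]
    have := hfP i none
    simp only [g, P, Option.elim, mul_one] at this
    rw [this, ofReal_measureReal]
  have hfst : π.map Prod.fst = ν := by
    ext A hA
    rw [Measure.map_apply measurable_fst hA]
    simp only [π, Measure.coe_finsetSum, Finset.sum_apply]
    have h1 : ∀ i : s, (ρ i).map (fun y => ((i : Ed d), y)) (Prod.fst ⁻¹' A)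
        = A.indicator (fun x => ν {x}) i := by
      intro i
      rw [Measure.map_apply (hmk i) (measurable_fst hA)]
      by_cases h : (i : Ed d) ∈ A
      · rw [Set.indicator_of_mem h, ← hρ]
        congr 1
        ext y; simp [h]
      · rw [Set.indicator_of_notMem h]
        convert measure_empty (μ := ρ i)
        ext y; simp [h]
    rw [Finset.sum_congr rfl fun i _ => h1 i, Finset.sum_coe_sort s (A.indicator fun x => ν {x})]
    have h2 : ν A = ν ((s.filter (· ∈ A) : Finset (Ed d)) : Set (Ed d)) := by
      rw [← Measure.restrict_eq_self_of_ae_mem (s := (s : Set (Ed d))) (μ := ν) hs,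
        Measure.restrict_apply hA, Measure.restrict_apply (Finset.measurableSet _)]
      congr 1
      ext y; simp; tauto
    rw [h2, ← sum_measure_singleton, Finset.sum_filter]
    rfl
  have hsnd : π.map Prod.snd = μ := by
    ext B hB
    rw [Measure.map_apply measurable_snd hB]
    simp only [π, Measure.coe_finsetSum, Finset.sum_apply]
    have h1 : ∀ i : s, (ρ i).map (fun y => ((i : Ed d), y)) (Prod.snd ⁻¹' B)
        = ∫⁻ y in B, ENNReal.ofReal (f i y) ∂μ := by
      intro i
      rw [Measure.map_apply (hmk i) (measurable_snd hB)]
      exact withDensity_apply _ hB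
    rw [Finset.sum_congr rfl fun i _ => h1 i, ← lintegral_finsetSum _ fun i _ => hfm' i]
    have h2 : ∀ᵐ y ∂(μ.restrict B), ∑ i, ENNReal.ofReal (f i y) = 1 := by
      refine ae_restrict_of_ae ?_
      filter_upwards [hf1, ae_all_iff.2 hf0] with y h1 h0
      rw [← ENNReal.ofReal_sum_of_nonneg fun i _ => h0 i, h1, ENNReal.ofReal_one]
    rw [lintegral_congr_ae h2]
    simp
  have hprob : IsProbabilityMeasure π := by
    constructor
    have : π univ = π.map Prod.snd univ := by
      rw [Measure.map_apply measurable_snd MeasurableSet.univ, preimage_univ]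
    rw [this, hsnd, measure_univ]
  refine ⟨π, hprob, ⟨hfst, hsnd⟩, fun A hA => ?_⟩
  have hAm : MeasurableSet (A ×ˢ (univ : Set (Ed d))) := hA.prod MeasurableSet.univ
  rw [← integral_indicator hAm]
  have hlt : ∀ i, ∀ᵐ y ∂μ, ENNReal.ofReal (f i y) < ⊤ := fun i =>
    Filter.Eventually.of_forall fun y => ENNReal.ofReal_lt_top
  have hmeas : Measurable ((A ×ˢ (univ : Set (Ed d))).indicator fun q : Ed d × Ed d => q.2 - q.1) :=
    (measurable_snd.sub measurable_fst).indicator hAm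
  have hsub : ∀ i : s, MemLp (fun y : Ed d => y - (i : Ed d)) 2 μ := fun i =>
    hμ.sub (memLp_const (i : Ed d))
  have hbase : ∀ i : s, Integrable (fun y => f i y • (y - (i : Ed d))) μ := fun i =>
    memLp_one_iff_integrable.1 ((hsub i).smul (hfL i))
  have hbase' : ∀ i : s, Integrable (fun y => (ENNReal.ofReal (f i y)).toReal • (y - (i : Ed d))) μ := by
    intro i
    refine (hbase i).congr ?_
    filter_upwards [hf0 i] with y hy
    rw [ENNReal.toReal_ofReal hy]
  have hind : ∀ i : s, ((A ×ˢ (univ : Set (Ed d))).indicator fun q : Ed d × Ed d => q.2 - q.1) ∘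
      (fun y => ((i : Ed d), y)) = if (i : Ed d) ∈ A then (fun y => y - (i : Ed d)) else 0 := by
    intro i
    funext y
    by_cases h : (i : Ed d) ∈ A <;> simp [h, Set.indicator]
  have hintρ : ∀ i : s, Integrable (fun y => y - (i : Ed d)) (ρ i) := fun i =>
    (integrable_withDensity_iff_integrable_smul' (hfm' i) (hlt i)).2 (hbase' i)
  rw [integral_finsetSum_measure]
  · refine Finset.sum_eq_zero fun i _ => ?_
    rw [integral_map (hmk i).aemeasurable hmeas.aestronglyMeasurable]
    change ∫ y, (((A ×ˢ (univ : Set (Ed d))).indicator fun q : Ed d × Ed d => q.2 - q.1) ∘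
      (fun y => ((i : Ed d), y))) y ∂(ρ i) = 0
    rw [hind]
    split_ifs with h
    · simp only [ρ]
      rw [integral_withDensity_eq_integral_toReal_smul (hfm' i) (hlt i)]
      have : ∫ y, (ENNReal.ofReal (f i y)).toReal • (y - (i : Ed d)) ∂μ
          = ∫ y, f i y • (y - (i : Ed d)) ∂μ := by
        refine integral_congr_ae ?_
        filter_upwards [hf0 i] with y hy
        rw [ENNReal.toReal_ofReal hy]
      rw [this]
      ext j
      rw [eval_integral_piLp fun j => (hbase i).eval_piLp j]
      have h1 := hfP i none
      have h2 := hfP i (some j)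
      simp only [g, P, Option.elim, mul_one] at h1 h2
      have h3 : ∀ y : Ed d, (f i y • (y - (i : Ed d))) j = f i y * y j - f i y * (i : Ed d) j := by
        intro y
        simp [mul_sub]
      simp_rw [h3]
      rw [integral_sub, integral_mul_const, h1, h2]
      · simp
      · exact (hfL i).integrable_mul (hμ.eval_piLp j)
      · exact (hfi i).mul_const _
    · simp
  · intro i _
    rw [integrable_map_measure hmeas.aestronglyMeasurable (hmk i).aemeasurable, hind]
    split_ifs with h
    · exact hintρ i
    · exact integrable_zero _ _ _

theorem coupling_cost {d : ℕ} (μ ν : Measure (Ed d)) [IsProbabilityMeasure μ]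
    [IsProbabilityMeasure ν] (hμ : MemLp (fun x : Ed d => x) 2 μ)
    (s : Finset (Ed d)) (hs : ν ((s : Set (Ed d))ᶜ) = 0) (π : Measure (Ed d × Ed d))
    [IsProbabilityMeasure π] (hπ : IsCoupling π ν μ) :
    Integrable (fun q : Ed d × Ed d => q.2) π ∧
    pCost 2 π = ∫ x, ‖x‖ ^ (2 : ℝ) ∂ν + ∫ x, ‖x‖ ^ (2 : ℝ) ∂μ
      - 2 * ∑ x ∈ s, inner ℝ x (∫ q in Prod.fst ⁻¹' {x}, q.2 ∂π) := by
  obtain ⟨h1, h2⟩ := hπ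
  have hν : MemLp (fun x : Ed d => x) 2 ν := by
    exact (memLp_two_iff_integrable_sq_norm (f := fun x : Ed d => x)
      (by fun_prop)).2 (fin_int ν s hs _).1
  have L1 : MemLp (fun q : Ed d × Ed d => q.1) 2 π := by
    rw [← h1] at hν
    exact (memLp_map_measure_iff measurable_id.aestronglyMeasurable measurable_fst.aemeasurable).1 hν
  have L2 : MemLp (fun q : Ed d × Ed d => q.2) 2 π := by
    rw [← h2] at hμ
    exact (memLp_map_measure_iff measurable_id.aestronglyMeasurable measurable_snd.aemeasurable).1 hμ
  have i1 : Integrable (fun q : Ed d × Ed d => ‖q.1‖ ^ 2) π := L1.integrable_norm_pow (by norm_num)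
  have i2 : Integrable (fun q : Ed d × Ed d => ‖q.2‖ ^ 2) π := L2.integrable_norm_pow (by norm_num)
  have i3 : Integrable (fun q : Ed d × Ed d => ‖q.2 - q.1‖ ^ 2) π :=
    (L2.sub L1).integrable_norm_pow (by norm_num)
  have id2 : ∀ q : Ed d × Ed d, ‖q.2 - q.1‖ ^ 2 = ‖q.1‖ ^ 2 + ‖q.2‖ ^ 2 - 2 * inner ℝ q.1 q.2 := by
    intro q
    rw [norm_sub_sq_real, real_inner_comm]; ring
  have i4 : Integrable (fun q : Ed d × Ed d => (inner ℝ q.1 q.2 : ℝ)) π := by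
    refine (((i1.add i2).sub i3).const_mul (1 / 2)).congr (Filter.Eventually.of_forall fun q => ?_)
    have := id2 q
    simp only [Pi.sub_apply, Pi.add_apply]
    linarith
  have i5 : Integrable (fun q : Ed d × Ed d => q.2) π := L2.integrable (by norm_num)
  refine ⟨i5, ?_⟩
  have e1 : ∫ x, ‖x‖ ^ 2 ∂ν = ∫ q, ‖q.1‖ ^ 2 ∂π := by
    rw [← h1, integral_map measurable_fst.aemeasurable (by fun_prop)]
  have e2 : ∫ x, ‖x‖ ^ 2 ∂μ = ∫ q, ‖q.2‖ ^ 2 ∂π := by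
    rw [← h2, integral_map measurable_snd.aemeasurable (by fun_prop)]
  have hae : ∀ᵐ q ∂π, q ∈ ⋃ x ∈ s, (Prod.fst ⁻¹' {x} : Set (Ed d × Ed d)) := by
    have : ∀ᵐ x ∂(π.map Prod.fst), x ∈ (s : Set (Ed d)) := by rw [h1]; exact hs
    filter_upwards [ae_of_ae_map measurable_fst.aemeasurable this] with q hq
    simpa using hq
  have e3 : ∫ q, (inner ℝ q.1 q.2 : ℝ) ∂π
      = ∑ x ∈ s, inner ℝ x (∫ q in Prod.fst ⁻¹' {x}, q.2 ∂π) := by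
    conv_lhs => rw [← Measure.restrict_eq_self_of_ae_mem hae]
    rw [integral_biUnion_finset s (fun x _ => measurable_fst (measurableSet_singleton x)) _
      (fun x _ => i4.integrableOn)]
    · refine Finset.sum_congr rfl fun x _ => ?_
      rw [← integral_inner i5.integrableOn]
      refine setIntegral_congr_fun (measurable_fst (measurableSet_singleton x)) fun q hq => ?_
      have : q.1 = x := hq
      simp only [this]
    · intro x _ y _ hxy
      exact Disjoint.preimage _ (by simpa using hxy)
  simp only [pCost, Real.rpow_ofNat]
  have i12 : Integrable (fun q : Ed d × Ed d => ‖q.1‖ ^ 2 + ‖q.2‖ ^ 2) π := i1.add i2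
  rw [e1, e2, ← e3, ← integral_add i1 i2, ← integral_const_mul,
    ← integral_sub i12 (i4.const_mul 2)]
  simp_rw [id2]

theorem martingale_cost {d : ℕ} (μ ν : Measure (Ed d)) [IsProbabilityMeasure μ]
    [IsProbabilityMeasure ν] (hμ : MemLp (fun x : Ed d => x) 2 μ)
    (s : Finset (Ed d)) (hs : ν ((s : Set (Ed d))ᶜ) = 0) (π : Measure (Ed d × Ed d))
    (hπ : IsMartingaleCoupling π ν μ) :
    pCost 2 π = ∫ x, ‖x‖ ^ (2 : ℝ) ∂μ - ∫ x, ‖x‖ ^ (2 : ℝ) ∂ν := by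
  obtain ⟨hp, hc, hm⟩ := hπ
  obtain ⟨i5, hcost⟩ := coupling_cost μ ν hμ s hs π hc
  have h1 : ∀ x ∈ s, inner ℝ x (∫ q in Prod.fst ⁻¹' {x}, q.2 ∂π) = ν.real {x} • ‖x‖ ^ (2 : ℝ) := by
    intro x _
    have h := hm {x} (measurableSet_singleton x)
    have hset : ({x} : Set (Ed d)) ×ˢ (univ : Set (Ed d)) = Prod.fst ⁻¹' {x} := by
      ext q; simp
    have hms : MeasurableSet (Prod.fst ⁻¹' {x} : Set (Ed d × Ed d)) :=
      measurable_fst (measurableSet_singleton x)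
    rw [hset, setIntegral_congr_fun (g := fun q => q.2 - x) hms (fun q hq => by
      have : q.1 = x := hq
      simp only [this]), integral_sub i5.integrableOn (integrable_const _), setIntegral_const,
      sub_eq_zero] at h
    have hν : π.real (Prod.fst ⁻¹' {x}) = ν.real {x} := by
      rw [← hc.1, map_measureReal_apply measurable_fst (measurableSet_singleton x)]
    rw [h, hν, real_inner_smul_right, real_inner_self_eq_norm_sq, smul_eq_mul, Real.rpow_ofNat]
  rw [hcost, Finset.sum_congr rfl h1, ← (fin_int ν s hs _).2]
  ring

theorem convexOn_sq_norm (d : ℕ) : ConvexOn ℝ univ fun x : Ed d => ‖x‖ ^ (2 : ℝ) := by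
  simp only [Real.rpow_ofNat]
  exact convexOn_univ_norm.pow (fun x _ => norm_nonneg x) 2

/-- Barycentres of a coupling give an admissible measure and bound the cost from below. -/
theorem coupling_lower {d N : ℕ} (μ ν : Measure (Ed d)) [IsProbabilityMeasure μ]
    [IsProbabilityMeasure ν] (hμ : MemLp (fun x : Ed d => x) 2 μ)
    (hν : SuppLE N ν) (π : Measure (Ed d × Ed d))
    [IsProbabilityMeasure π] (hπ : IsCoupling π ν μ) :
    ∃ η : Measure (Ed d), IsProbabilityMeasure η ∧ SuppLE N η ∧ ConvexOrder η μ ∧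
      ∫ x, ‖x‖ ^ (2 : ℝ) ∂ν + ∫ x, ‖x‖ ^ (2 : ℝ) ∂μ
        - 2 * (√(∫ x, ‖x‖ ^ (2 : ℝ) ∂ν) * √(∫ x, ‖x‖ ^ (2 : ℝ) ∂η)) ≤ pCost 2 π := by
  classical
  obtain ⟨s, hsN, hs⟩ := hν
  obtain ⟨i5, hcost⟩ := coupling_cost μ ν hμ s hs π hπ
  have hms : ∀ x, MeasurableSet (Prod.fst ⁻¹' {x} : Set (Ed d × Ed d)) := fun x =>
    measurable_fst (measurableSet_singleton x)
  have hνπ' : ∀ x, π (Prod.fst ⁻¹' {x}) = ν {x} := fun x => by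
    rw [← hπ.1, Measure.map_apply measurable_fst (measurableSet_singleton x)]
  have hνπ : ∀ x, π.real (Prod.fst ⁻¹' {x}) = ν.real {x} := fun x => by
    simp only [measureReal_def, hνπ']
  let m : Ed d → Ed d := fun x => ⨍ q in Prod.fst ⁻¹' {x}, q.2 ∂π
  let η : Measure (Ed d) := ∑ x ∈ s, ν {x} • Measure.dirac (m x)
  have hηi : ∀ h : Ed d → ℝ, ∫ y, h y ∂η = ∑ x ∈ s, ν.real {x} * h (m x) := by
    intro h
    simp only [η]
    rw [integral_finsetSum_measure]
    · refine Finset.sum_congr rfl fun x _ => ?_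
      rw [integral_smul_measure, integral_dirac]
      rfl
    · intro x _
      exact (integrable_dirac (by simp)).smul_measure (measure_ne_top _ _)
  have hηp : IsProbabilityMeasure η := by
    constructor
    simp only [η, Measure.coe_finsetSum, Finset.sum_apply, Measure.smul_apply, measure_univ,
      smul_eq_mul, mul_one]
    rw [sum_measure_singleton]
    exact (prob_compl_eq_zero_iff s.measurableSet).1 hs
  refine ⟨η, hηp, ⟨s.image m, Finset.card_image_le.trans hsN, ?_⟩, ?_, ?_⟩
  · simp only [η, Measure.coe_finsetSum, Finset.sum_apply, Measure.smul_apply, smul_eq_mul]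
    refine Finset.sum_eq_zero fun x hx => ?_
    rw [Measure.dirac_apply' _ (Finset.measurableSet _).compl, Set.indicator_of_notMem, mul_zero]
    simp only [Set.mem_compl_iff, not_not, Finset.mem_coe]
    exact Finset.mem_image_of_mem m hx
  · intro φ hφ _ hφμ
    have hφπ : Integrable (fun q : Ed d × Ed d => φ q.2) π := by
      rw [← hπ.2] at hφμ
      exact hφμ.comp_measurable measurable_snd
    have hφc : ContinuousOn φ univ := hφ.continuousOn isOpen_univ
    have e2 : ∫ x, φ x ∂μ = ∫ q, φ q.2 ∂π := by
      rw [← hπ.2, integral_map measurable_snd.aemeasurable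
        (continuousOn_univ.1 hφc).aestronglyMeasurable]
    have hae : ∀ᵐ q ∂π, q ∈ ⋃ x ∈ s, (Prod.fst ⁻¹' {x} : Set (Ed d × Ed d)) := by
      have : ∀ᵐ x ∂(π.map Prod.fst), x ∈ (s : Set (Ed d)) := by rw [hπ.1]; exact hs
      filter_upwards [ae_of_ae_map measurable_fst.aemeasurable this] with q hq
      simpa using hq
    rw [hηi, e2]
    conv_rhs => rw [← Measure.restrict_eq_self_of_ae_mem hae]
    rw [integral_biUnion_finset s (fun x _ => hms x) _ (fun x _ => hφπ.integrableOn)]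
    · refine Finset.sum_le_sum fun x _ => ?_
      by_cases h0 : ν {x} = 0
      · have : ν.real {x} = 0 := by simp [measureReal_def, h0]
        rw [this, zero_mul, Measure.restrict_eq_zero.2 ((hνπ' x).trans h0)]
        simp
      · rw [← measure_smul_setAverage _ (measure_ne_top _ _), hνπ, smul_eq_mul]
        refine mul_le_mul_of_nonneg_left ?_ measureReal_nonneg
        exact hφ.map_set_average_le hφc isClosed_univ (by rwa [hνπ']) (measure_ne_top _ _)
          (by simp) i5.integrableOn hφπ.integrableOn
    · intro x _ y _ hxy
      exact Disjoint.preimage _ (by simpa using hxy)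
  · rw [hcost, hηi, (fin_int ν s hs _).2]
    have h1 : ∀ x ∈ s, inner ℝ x (∫ q in Prod.fst ⁻¹' {x}, q.2 ∂π)
        ≤ (√(ν.real {x}) * ‖x‖) * (√(ν.real {x}) * ‖m x‖) := by
      intro x _
      rw [← measure_smul_setAverage _ (measure_ne_top _ _), hνπ, real_inner_smul_right]
      have h2 : √(ν.real {x}) * √(ν.real {x}) = ν.real {x} := Real.mul_self_sqrt measureReal_nonneg
      calc ν.real {x} * inner ℝ x (m x) ≤ ν.real {x} * (‖x‖ * ‖m x‖) :=
            mul_le_mul_of_nonneg_left (real_inner_le_norm _ _) measureReal_nonneg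
        _ = (√(ν.real {x}) * √(ν.real {x})) * (‖x‖ * ‖m x‖) := by rw [h2]
        _ = _ := by ring
    have h3 := (Finset.sum_le_sum h1).trans (Real.sum_mul_le_sqrt_mul_sqrt s _ _)
    have h4 : ∀ x (t : ℝ), (√(ν.real {x}) * t) ^ 2 = ν.real {x} * t ^ 2 := fun x t => by
      rw [mul_pow, Real.sq_sqrt measureReal_nonneg]
    simp only [h4] at h3
    simp only [Real.rpow_ofNat, smul_eq_mul]
    linarith

theorem WpPow_comm' {d : ℕ} (μ ν : Measure (Ed d)) : WpPow 2 μ ν = WpPow 2 ν μ := by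
  have key : ∀ μ ν : Measure (Ed d), ∀ c, (∃ π : Measure (Ed d × Ed d), IsProbabilityMeasure π ∧
      IsCoupling π μ ν ∧ c = pCost 2 π) → (∃ π : Measure (Ed d × Ed d), IsProbabilityMeasure π ∧
      IsCoupling π ν μ ∧ c = pCost 2 π) := by
    rintro μ ν c ⟨π, hp, ⟨h1, h2⟩, rfl⟩
    refine ⟨π.map Prod.swap, Measure.isProbabilityMeasure_map measurable_swap.aemeasurable,
      ⟨?_, ?_⟩, ?_⟩
    · rw [Measure.map_map measurable_fst measurable_swap, ← h2]; rfl
    · rw [Measure.map_map measurable_snd measurable_swap, ← h1]; rfl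
    · simp only [pCost, Real.rpow_ofNat]
      rw [integral_map measurable_swap.aemeasurable (by fun_prop)]
      simp only [Prod.fst_swap, Prod.snd_swap, norm_sub_rev]
  unfold WpPow
  congr 1
  ext c
  exact ⟨key μ ν c, key ν μ c⟩

theorem stmt6 (d N : ℕ) (μ : Measure (Ed d)) [IsProbabilityMeasure μ]
    (hμ2 : Integrable (fun x => ‖x‖ ^ (2 : ℝ)) μ)
    (ν : Measure (Ed d)) (hν : IsProbabilityMeasure ν) (hνN : SuppLE N ν)
    (hνμ : ConvexOrder ν μ) :
    (Wp 2 μ ν = sInf {c | ∃ η : Measure (Ed d), IsProbabilityMeasure η ∧ SuppLE N η ∧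
          ConvexOrder η μ ∧ c = Wp 2 μ η} ↔
        ∫ x, ‖x‖ ^ (2 : ℝ) ∂ν
          = sSup {c | ∃ η : Measure (Ed d), IsProbabilityMeasure η ∧ SuppLE N η ∧
              ConvexOrder η μ ∧ c = ∫ x, ‖x‖ ^ (2 : ℝ) ∂η}) ∧
      (∫ x, ‖x‖ ^ (2 : ℝ) ∂ν
          = sSup {c | ∃ η : Measure (Ed d), IsProbabilityMeasure η ∧ SuppLE N η ∧
              ConvexOrder η μ ∧ c = ∫ x, ‖x‖ ^ (2 : ℝ) ∂η} →
        Wp 2 ν μ = Mp 2 ν μ) := by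
  have hμ : MemLp (fun x : Ed d => x) 2 μ := by
    exact (memLp_two_iff_integrable_sq_norm (f := fun x : Ed d => x)
      (by fun_prop)).2 (by simpa using hμ2)
  set Q : Set ℝ := {c | ∃ η : Measure (Ed d), IsProbabilityMeasure η ∧ SuppLE N η ∧
              ConvexOrder η μ ∧ c = ∫ x, ‖x‖ ^ (2 : ℝ) ∂η} with hQ
  set R : Set ℝ := {c | ∃ η : Measure (Ed d), IsProbabilityMeasure η ∧ SuppLE N η ∧
          ConvexOrder η μ ∧ c = Wp 2 μ η} with hR
  set B : ℝ := ∫ x, ‖x‖ ^ (2 : ℝ) ∂μ with hB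
  have hQb : BddAbove Q := by
    refine ⟨B, ?_⟩
    rintro c ⟨η, hη, ⟨s, _, hs⟩, hηc, rfl⟩
    exact hηc _ (convexOn_sq_norm d) (fin_int η s hs _).1 hμ2
  have hQne : Q.Nonempty := ⟨_, ν, hν, hνN, hνμ, rfl⟩
  set S : ℝ := sSup Q with hS
  have hle : ∀ η : Measure (Ed d), IsProbabilityMeasure η → SuppLE N η → ConvexOrder η μ →
      ∫ x, ‖x‖ ^ (2 : ℝ) ∂η ≤ S := fun η h1 h2 h3 => le_csSup hQb ⟨η, h1, h2, h3, rfl⟩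
  have hnn : ∀ η : Measure (Ed d), 0 ≤ ∫ x, ‖x‖ ^ (2 : ℝ) ∂η := fun η =>
    integral_nonneg fun x => by positivity
  have hS0 : 0 ≤ S := (hnn ν).trans (hle ν hν hνN hνμ)
  have hSB : S ≤ B := by
    refine csSup_le hQne ?_
    rintro c ⟨η, hη, ⟨s, _, hs⟩, hηc, rfl⟩
    exact hηc _ (convexOn_sq_norm d) (fin_int η s hs _).1 hμ2
  -- martingale cost
  have hM : ∀ η : Measure (Ed d), IsProbabilityMeasure η → SuppLE N η → ConvexOrder η μ →
      MpPow 2 η μ = B - ∫ x, ‖x‖ ^ (2 : ℝ) ∂η := by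
    rintro η hη ⟨s, _, hs⟩ hηc
    obtain ⟨π, hπ⟩ := strassen_fin μ η hμ s hs hηc
    have : {c | ∃ π : Measure (Ed d × Ed d), IsMartingaleCoupling π η μ ∧ c = pCost 2 π}
        = {B - ∫ x, ‖x‖ ^ (2 : ℝ) ∂η} := by
      ext c
      constructor
      · rintro ⟨π, hπ, rfl⟩
        exact martingale_cost μ η hμ s hs π hπ
      · rintro rfl
        exact ⟨π, hπ, (martingale_cost μ η hμ s hs π hπ).symm⟩
    unfold MpPow
    rw [this, csInf_singleton]
  have hbdd : ∀ η : Measure (Ed d), BddBelow {c | ∃ π : Measure (Ed d × Ed d),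
      IsProbabilityMeasure π ∧ IsCoupling π η μ ∧ c = pCost 2 π} := by
    refine fun η => ⟨0, ?_⟩
    rintro c ⟨π, _, _, rfl⟩
    exact integral_nonneg fun q => by positivity
  have hup : ∀ η : Measure (Ed d), IsProbabilityMeasure η → SuppLE N η → ConvexOrder η μ →
      WpPow 2 η μ ≤ B - ∫ x, ‖x‖ ^ (2 : ℝ) ∂η := by
    rintro η hη ⟨s, _, hs⟩ hηc
    obtain ⟨π, hπ⟩ := strassen_fin μ η hμ s hs hηc
    rw [← martingale_cost μ η hμ s hs π hπ]
    exact csInf_le (hbdd η) ⟨π, hπ.1, hπ.2.1, rfl⟩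
  have hlow : ∀ η : Measure (Ed d), IsProbabilityMeasure η → SuppLE N η → ConvexOrder η μ →
      B - S + (√(∫ x, ‖x‖ ^ (2 : ℝ) ∂η) - √S) ^ 2 ≤ WpPow 2 η μ := by
    intro η hη hηN hηc
    refine le_csInf ?_ ?_
    · obtain ⟨s, _, hs⟩ := hηN
      obtain ⟨π, hπ⟩ := strassen_fin μ η hμ s hs hηc
      exact ⟨_, π, hπ.1, hπ.2.1, rfl⟩
    · rintro c ⟨π, hp, hπ, rfl⟩
      obtain ⟨ζ, h1, h2, h3, h4⟩ := coupling_lower μ η hμ hηN π hπ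
      refine le_trans ?_ h4
      have h5 := Real.sqrt_le_sqrt (hle ζ h1 h2 h3)
      have h6 := mul_le_mul_of_nonneg_left h5 (Real.sqrt_nonneg (∫ x, ‖x‖ ^ (2 : ℝ) ∂η))
      have h7 := Real.sq_sqrt hS0
      have h8 := Real.sq_sqrt (hnn η)
      rw [sub_sq, h7, h8]
      linarith
  have hW : ∀ η : Measure (Ed d), Wp 2 μ η = √(WpPow 2 η μ) := fun η => by
    rw [Wp, WpPow_comm', Real.sqrt_eq_rpow]
  have hRinf : sInf R = √(B - S) := by
    refine le_antisymm ?_ ?_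
    · have hRb : BddBelow R := by
        refine ⟨0, ?_⟩
        rintro c ⟨η, _, _, _, rfl⟩
        rw [hW]; exact Real.sqrt_nonneg _
      have h0 : 0 ≤ sInf R := by
        refine Real.sInf_nonneg ?_
        rintro c ⟨η, _, _, _, rfl⟩
        rw [hW]; exact Real.sqrt_nonneg _
      refine Real.le_sqrt_of_sq_le ?_
      have : S ≤ B - sInf R ^ 2 := by
        refine csSup_le hQne ?_
        rintro c ⟨η, h1, h2, h3, rfl⟩
        have h4 : sInf R ≤ √(B - ∫ x, ‖x‖ ^ (2 : ℝ) ∂η) := by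
          refine (csInf_le hRb ⟨η, h1, h2, h3, rfl⟩).trans ?_
          rw [hW]
          exact Real.sqrt_le_sqrt (hup η h1 h2 h3)
        have h5 := pow_le_pow_left₀ h0 h4 2
        rw [Real.sq_sqrt (by linarith [hle η h1 h2 h3])] at h5
        linarith
      linarith
    · refine le_csInf ⟨_, ν, hν, hνN, hνμ, rfl⟩ ?_
      rintro c ⟨η, h1, h2, h3, rfl⟩
      rw [hW]
      refine Real.sqrt_le_sqrt (le_trans ?_ (hlow η h1 h2 h3))
      linarith [sq_nonneg (√(∫ x, ‖x‖ ^ (2 : ℝ) ∂η) - √S)]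
  have hlν := hlow ν hν hνN hνμ
  have huν := hup ν hν hνN hνμ
  have heq : ∫ x, ‖x‖ ^ (2 : ℝ) ∂ν = S → WpPow 2 ν μ = B - S := by
    intro h
    rw [h] at hlν huν
    refine le_antisymm huν ?_
    simpa using hlν
  refine ⟨⟨fun h => ?_, fun h => ?_⟩, fun h => ?_⟩
  · rw [hW, hRinf] at h
    have hWnn : 0 ≤ WpPow 2 ν μ := by
      linarith [sq_nonneg (√(∫ x, ‖x‖ ^ (2 : ℝ) ∂ν) - √S)]
    rw [Real.sqrt_inj hWnn (by linarith)] at h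
    have h2 : (√(∫ x, ‖x‖ ^ (2 : ℝ) ∂ν) - √S) ^ 2 = 0 :=
      le_antisymm (by linarith) (sq_nonneg _)
    have h3 := sub_eq_zero.1 (pow_eq_zero_iff (two_ne_zero)|>.1 h2)
    exact (Real.sqrt_inj (hnn ν) hS0).1 h3
  · rw [hW, hRinf, heq h]
  · rw [Wp, Mp, heq h, hM ν hν hνN hνμ, h]
end
end

section
/- Let μ be the uniform distribution on [0,1] and p ≥ 1. Then the measure μ̂_N = (1/N) Σ_{k=1}^N δ_{(2k−1)/(2N)} is the unique W_p-projection of μ onto the set of probability measures on ℝ supported on at most N points, and W_p(μ, P(ℝ,N)) = 1/(2(p+1)^{1/p} N). -/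
open MeasureTheory Set

noncomputable section

variable {E : Type*} [NormedAddCommGroup E] [NormedSpace ℝ E] [MeasurableSpace E] [BorelSpace E]

/-- The optimal primal `N`-quantization of the uniform distribution on `[0,1]`. -/
def unifPrimalQuant (N : ℕ) : Measure ℝ :=
  ((N : ENNReal))⁻¹ • ∑ k ∈ Finset.range N, Measure.dirac ((2 * (k : ℝ) + 1) / (2 * N))

lemma q_integral_abs (p : ℝ) (hp : 1 ≤ p) (a y : ℝ) (ha : 0 ≤ a) :
    ∫ x in (y - a)..(y + a), |x - y| ^ p = 2 * a ^ (p + 1) / (p + 1) := by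
  have h0 : ∫ x in (0:ℝ)..a, |x| ^ p = a ^ (p + 1) / (p + 1) := by
    have : ∫ x in (0:ℝ)..a, |x| ^ p = ∫ x in (0:ℝ)..a, x ^ p := by
      apply intervalIntegral.integral_congr
      intro x hx
      rw [uIcc_of_le ha] at hx
      simp only [abs_of_nonneg hx.1]
    rw [this, integral_rpow (Or.inl (by linarith)), Real.zero_rpow (by linarith), sub_zero]
  have h1 : ∫ x in (-a)..(0:ℝ), |x| ^ p = a ^ (p + 1) / (p + 1) := by
    have := intervalIntegral.integral_comp_neg (a := -a) (b := 0) (fun x : ℝ => |x| ^ p)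
    simp only [abs_neg, neg_zero, neg_neg] at this
    rw [this, h0]
  have hc : Continuous (fun x : ℝ => |x| ^ p) :=
    continuous_abs.rpow_const (fun _ => Or.inr (by linarith))
  have := intervalIntegral.integral_comp_sub_right (a := y - a) (b := y + a)
    (fun x : ℝ => |x| ^ p) y
  rw [this, show y - a - y = -a by ring, show y + a - y = a by ring,
    ← intervalIntegral.integral_add_adjacent_intervals (hc.intervalIntegrable _ _)
      (hc.intervalIntegrable 0 _), h0, h1]
  ring

/-- The bump function. -/
def qg (p a y x : ℝ) : ℝ := max (a ^ p - |x - y| ^ p) 0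

lemma qg_nonneg (p a y x : ℝ) : 0 ≤ qg p a y x := le_max_right _ _

lemma qg_cont (p : ℝ) (hp : 1 ≤ p) (a y : ℝ) : Continuous (qg p a y) := by
  have hc : Continuous (fun x : ℝ => |x - y| ^ p) :=
    (continuous_abs.comp (continuous_id.sub continuous_const)).rpow_const
      (fun _ => Or.inr (by linarith))
  exact (continuous_const.sub hc).max continuous_const

lemma qg_pos (p : ℝ) (hp : 1 ≤ p) (a y x : ℝ) (h : |x - y| < a) : 0 < qg p a y x := by
  have := Real.rpow_lt_rpow (abs_nonneg _) h (show 0 < p by linarith)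
  exact lt_max_of_lt_left (by linarith)

lemma qg_zero (p : ℝ) (hp : 1 ≤ p) (a y x : ℝ) (ha : 0 ≤ a) (h : a ≤ |x - y|) :
    qg p a y x = 0 := by
  have := Real.rpow_le_rpow ha h (show 0 ≤ p by linarith)
  exact max_eq_right (by linarith)

lemma qg_eq_ind (p : ℝ) (hp : 1 ≤ p) (a y : ℝ) (ha : 0 ≤ a) :
    qg p a y = (Ioc (y - a) (y + a)).indicator (fun x => a ^ p - |x - y| ^ p) := by
  ext x
  by_cases hx : x ∈ Ioc (y - a) (y + a)
  · rw [indicator_of_mem hx]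
    have : |x - y| ≤ a := abs_le.2 ⟨by linarith [hx.1], by linarith [hx.2]⟩
    have := Real.rpow_le_rpow (abs_nonneg _) this (show 0 ≤ p by linarith)
    exact max_eq_left (by linarith)
  · rw [indicator_of_notMem hx]
    apply qg_zero p hp a y x ha
    by_contra h
    have := abs_lt.1 (not_le.1 h)
    exact hx ⟨by linarith, by linarith⟩

lemma qg_integrable (p : ℝ) (hp : 1 ≤ p) (a y : ℝ) (ha : 0 ≤ a) :
    Integrable (qg p a y) := by
  have hc : Continuous (fun x : ℝ => a ^ p - |x - y| ^ p) :=
    continuous_const.sub ((continuous_abs.comp (continuous_id.sub continuous_const)).rpow_const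
      (fun _ => Or.inr (by linarith)))
  rw [qg_eq_ind p hp a y ha, integrable_indicator_iff measurableSet_Ioc]
  exact (hc.integrableOn_Icc).mono_set Ioc_subset_Icc_self

lemma qg_integral (p : ℝ) (hp : 1 ≤ p) (a y : ℝ) (ha : 0 ≤ a) :
    ∫ x, qg p a y x = 2 * a ^ (p + 1) * (p / (p + 1)) := by
  have hc : Continuous (fun x : ℝ => |x - y| ^ p) :=
    ((continuous_abs.comp (continuous_id.sub continuous_const)).rpow_const
      (fun _ => Or.inr (by linarith)))
  rw [qg_eq_ind p hp a y ha, integral_indicator measurableSet_Ioc,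
    ← intervalIntegral.integral_of_le (by linarith),
    intervalIntegral.integral_sub (by simp) (hc.intervalIntegrable _ _), q_integral_abs p hp a y ha,
    intervalIntegral.integral_const, Real.rpow_add_one' ha (by linarith)]
  have : p + 1 ≠ 0 := by linarith
  simp only [smul_eq_mul]
  field_simp
  ring

lemma qg_integral_le (p : ℝ) (hp : 1 ≤ p) (a y : ℝ) (ha : 0 ≤ a) :
    ∫ x in Icc (0:ℝ) 1, qg p a y x ≤ 2 * a ^ (p + 1) * (p / (p + 1)) := by
  rw [← qg_integral p hp a y ha]
  exact setIntegral_le_integral (qg_integrable p hp a y ha)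
    (Filter.Eventually.of_forall (qg_nonneg p a y))

lemma q_meas_eq (ν : Measure ℝ) (s : Finset ℝ) (hs : ν ((s : Set ℝ)ᶜ) = 0) :
    ν = ∑ y ∈ s, ν {y} • Measure.dirac y := by
  ext A hA
  rw [Measure.finsetSum_apply]
  have h1 : ν A = ν (A ∩ s) := by
    apply le_antisymm _ (measure_mono inter_subset_left)
    calc ν A ≤ ν ((A ∩ s) ∪ (s : Set ℝ)ᶜ) := measure_mono (by
            intro x hx; by_cases h : x ∈ (s : Set ℝ)
            · exact Or.inl ⟨hx, h⟩
            · exact Or.inr h)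
      _ ≤ ν (A ∩ s) + ν ((s : Set ℝ)ᶜ) := measure_union_le _ _
      _ = _ := by rw [hs, add_zero]
  classical
  have h2 : A ∩ s = ((s.filter (· ∈ A) : Finset ℝ) : Set ℝ) := by
    ext x; simp [and_comm]
  rw [h1, h2, ← sum_measure_singleton, Finset.sum_filter]
  apply Finset.sum_congr rfl
  intro y _
  simp [Measure.dirac_apply' _ hA, indicator]

lemma q_int (ν : Measure ℝ) [IsProbabilityMeasure ν] (s : Finset ℝ)
    (hs : ν ((s : Set ℝ)ᶜ) = 0) (u : ℝ → ℝ) :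
    Integrable u ν ∧ ∫ y, u y ∂ν = ∑ y ∈ s, ν.real {y} * u y := by
  have hi : ∀ y ∈ s, Integrable u (ν {y} • Measure.dirac y) := fun y _ =>
    (integrable_dirac (by simp)).smul_measure (measure_ne_top _ _)
  have e := q_meas_eq ν s hs
  constructor
  · rw [e]; exact integrable_finsetSum_measure.2 hi
  · conv_lhs => rw [e]
    rw [integral_finsetSum_measure hi]
    apply Finset.sum_congr rfl
    intro y _
    rw [integral_smul_measure, integral_dirac]; rfl

instance q_prob : IsProbabilityMeasure (volume.restrict (Icc (0:ℝ) 1)) := ⟨by simp⟩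

lemma q_dual (p : ℝ) (hp : 1 ≤ p) (ν : Measure ℝ) [IsProbabilityMeasure ν] (s : Finset ℝ)
    (hs : ν ((s : Set ℝ)ᶜ) = 0) (u G : ℝ → ℝ) (hG : Continuous G)
    (h : ∀ x, ∀ y ∈ s, u y - G x ≤ |y - x| ^ p) :
    ∑ y ∈ s, ν.real {y} * u y - ∫ x in Icc (0:ℝ) 1, G x
      ≤ WpPow p (volume.restrict (Icc (0:ℝ) 1)) ν := by
  apply le_csInf
  · refine ⟨_, (volume.restrict (Icc (0:ℝ) 1)).prod ν, inferInstance, ⟨?_, ?_⟩, rfl⟩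
    · simp [Measure.map_fst_prod]
    · simp [Measure.map_snd_prod]
  · rintro c ⟨π, hπ, ⟨h1, h2⟩, rfl⟩
    obtain ⟨iu, eu⟩ := q_int ν s hs u
    have iG : Integrable G (volume.restrict (Icc (0:ℝ) 1)) := hG.integrableOn_Icc
    have iu' : Integrable (fun q : ℝ × ℝ => u q.2) π := by
      rw [← h2] at iu
      exact (integrable_map_measure iu.1 measurable_snd.aemeasurable).1 iu
    have iG' : Integrable (fun q : ℝ × ℝ => G q.1) π := by
      rw [← h1] at iG
      exact (integrable_map_measure iG.1 measurable_fst.aemeasurable).1 iG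
    have e1 : ∫ q, u q.2 ∂π = ∑ y ∈ s, ν.real {y} * u y := by
      rw [← eu, ← h2]
      rw [← h2] at iu
      exact (integral_map measurable_snd.aemeasurable iu.1).symm
    have e2 : ∫ q, G q.1 ∂π = ∫ x in Icc (0:ℝ) 1, G x := by
      rw [← h1]
      rw [← h1] at iG
      exact (integral_map measurable_fst.aemeasurable iG.1).symm
    have a1 : ∀ᵐ q ∂π, q.1 ∈ Icc (0:ℝ) 1 := by
      apply ae_of_ae_map measurable_fst.aemeasurable
      rw [h1]
      exact ae_restrict_mem measurableSet_Icc
    have a2 : ∀ᵐ q ∂π, q.2 ∈ s := by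
      apply ae_of_ae_map (p := fun y => y ∈ s) measurable_snd.aemeasurable
      rw [h2]
      exact hs
    have ic : Integrable (fun q : ℝ × ℝ => ‖q.2 - q.1‖ ^ p) π := by
      have hc : Continuous (fun q : ℝ × ℝ => ‖q.2 - q.1‖ ^ p) :=
        (continuous_norm.comp (continuous_snd.sub continuous_fst)).rpow_const
          (fun _ => Or.inr (by linarith))
      apply Integrable.of_bound hc.aestronglyMeasurable ((∑ y ∈ s, |y| + 1) ^ p)
      filter_upwards [a1, a2] with q hq1 hq2
      rw [Real.norm_of_nonneg (by positivity)]
      apply Real.rpow_le_rpow (norm_nonneg _) _ (by linarith)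
      have : |q.2| ≤ ∑ y ∈ s, |y| :=
        Finset.single_le_sum (f := fun y : ℝ => |y|) (fun _ _ => abs_nonneg _) hq2
      have h3 : |q.1| ≤ 1 := abs_le.2 ⟨by linarith [hq1.1], hq1.2⟩
      exact (norm_sub_le _ _).trans (add_le_add this h3)
    rw [← e1, ← e2, ← integral_sub iu' iG']
    apply integral_mono_ae (iu'.sub iG') ic
    filter_upwards [a2] with q hq
    exact h q.1 q.2 hq

lemma q_cell (N : ℕ) (hN : 1 ≤ N) (n : ℕ) :
    ∑ k ∈ Finset.range n, volume.restrict (Ioc ((k:ℝ) / N) ((k + 1 : ℝ) / N))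
      = volume.restrict (Ioc (0:ℝ) ((n:ℝ) / N)) := by
  induction n with
  | zero => simp
  | succ n ih =>
    rw [Finset.sum_range_succ, ih, ← Measure.restrict_union _ measurableSet_Ioc,
      Ioc_union_Ioc_eq_Ioc]
    · push_cast; rfl
    · positivity
    · gcongr; linarith
    · exact Set.disjoint_left.2 fun x hx hy => absurd hx.2 (not_le.2 hy.1)

lemma q_upper (N : ℕ) (hN : 1 ≤ N) (p : ℝ) (hp : 1 ≤ p) :
    WpPow p (volume.restrict (Icc (0:ℝ) 1)) (unifPrimalQuant N)
      ≤ (1 / (2 * N : ℝ)) ^ p / (p + 1) := by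
  have hN0 : (0:ℝ) < N := by exact_mod_cast hN
  have hN1 : (N:ℝ) ≠ 0 := hN0.ne'
  set y : ℕ → ℝ := fun k => (2 * (k : ℝ) + 1) / (2 * N) with hy
  set π : Measure (ℝ × ℝ) := ∑ k ∈ Finset.range N,
    (volume.restrict (Ioc ((k:ℝ) / N) ((k + 1 : ℝ) / N))).map (fun x => (x, y k)) with hπ
  have hm : ∀ k, Measurable (fun x : ℝ => (x, y k)) := fun k => by fun_prop
  have hfst : π.map Prod.fst = volume.restrict (Icc (0:ℝ) 1) := by
    rw [hπ, Measure.map_finset_sum measurable_fst.aemeasurable]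
    simp only [Measure.map_map measurable_fst (hm _)]
    have : ∀ k, (Prod.fst ∘ fun x : ℝ => (x, y k)) = id := fun k => rfl
    simp only [this, Measure.map_id]
    rw [q_cell N hN N, div_self hN1]
    exact restrict_Ioc_eq_restrict_Icc
  have hsnd : π.map Prod.snd = unifPrimalQuant N := by
    rw [hπ, Measure.map_finset_sum measurable_snd.aemeasurable]
    simp only [Measure.map_map measurable_snd (hm _)]
    have : ∀ k, (Prod.snd ∘ fun x : ℝ => (x, y k)) = fun _ => y k := fun k => rfl
    simp only [this, Measure.map_const]
    rw [unifPrimalQuant, Finset.smul_sum]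
    apply Finset.sum_congr rfl
    intro k _
    congr 1
    rw [Measure.restrict_apply_univ, Real.volume_Ioc,
      show ((k:ℝ) + 1) / N - k / N = (N:ℝ)⁻¹ by field_simp; ring, ENNReal.ofReal_inv_of_pos hN0,
      ENNReal.ofReal_natCast]
  have hprob : IsProbabilityMeasure π := by
    constructor
    have : π.map Prod.fst univ = 1 := by rw [hfst]; simp
    rwa [Measure.map_apply measurable_fst MeasurableSet.univ] at this
  refine csInf_le ⟨0, ?_⟩ ⟨π, hprob, ⟨hfst, hsnd⟩, ?_⟩
  · rintro c ⟨π, _, _, rfl⟩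
    exact integral_nonneg fun q => by positivity
  · have hc : Continuous (fun q : ℝ × ℝ => ‖q.2 - q.1‖ ^ p) :=
        (continuous_norm.comp (continuous_snd.sub continuous_fst)).rpow_const
          (fun _ => Or.inr (by linarith))
    have hc2 : ∀ k, Continuous (fun x : ℝ => ‖y k - x‖ ^ p) := fun k =>
        (continuous_norm.comp (continuous_const.sub continuous_id)).rpow_const
          (fun _ => Or.inr (by linarith))
    rw [pCost, hπ, integral_finsetSum_measure]
    · have : ∀ k ∈ Finset.range N, ∫ q, ‖q.2 - q.1‖ ^ p
          ∂((volume.restrict (Ioc ((k:ℝ) / N) ((k + 1 : ℝ) / N))).map (fun x => (x, y k)))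
          = 2 * (1 / (2 * N : ℝ)) ^ (p + 1) / (p + 1) := by
        intro k _
        rw [integral_map (hm k).aemeasurable hc.aestronglyMeasurable,
          ← q_integral_abs p hp _ (y k) (by positivity), intervalIntegral.integral_of_le]
        · have e1 : y k - 1 / (2 * N) = k / N := by rw [hy]; field_simp; ring
          have e2 : y k + 1 / (2 * N) = (k + 1) / N := by rw [hy]; field_simp; ring
          rw [e1, e2]
          simp only [Real.norm_eq_abs, abs_sub_comm]
        · have : (0:ℝ) ≤ 1 / (2 * N) := by positivity
          linarith
      rw [Finset.sum_congr rfl this, Finset.sum_const, Finset.card_range, nsmul_eq_mul,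
        Real.rpow_add_one' (by positivity) (by linarith)]
      field_simp
    · intro k _
      rw [integrable_map_measure hc.aestronglyMeasurable (hm k).aemeasurable]
      exact ((hc2 k).integrableOn_Icc).mono_set Ioc_subset_Icc_self

lemma q_grid (N : ℕ) (hN : 1 ≤ N) (s : Finset ℝ) (hs : s.card = N)
    (h1 : ∀ y ∈ s, 1 / (2 * N : ℝ) ≤ y ∧ y ≤ 1 - 1 / (2 * N))
    (h2 : ∀ y ∈ s, ∀ z ∈ s, y < z → 1 / (N : ℝ) ≤ z - y) :
    s = (Finset.range N).image (fun k : ℕ => (2 * (k : ℝ) + 1) / (2 * N)) := by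
  have hN0 : (0:ℝ) < N := by exact_mod_cast hN
  let f := s.orderEmbOfFin hs
  have hf : ∀ i, f i ∈ s := fun i => Finset.orderEmbOfFin_mem s hs i
  have key : ∀ (d j : ℕ) (hj : j + d < N),
      (d : ℝ) / N ≤ f ⟨j + d, hj⟩ - f ⟨j, by omega⟩ := by
    intro d
    induction d with
    | zero => intro j hj; simp
    | succ d ih =>
      intro j hj
      have a := ih j (by omega)
      have b := h2 (f ⟨j + d, by omega⟩) (hf _) (f ⟨j + (d + 1), hj⟩) (hf _)
        (f.strictMono (by simp [Fin.lt_def]))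
      push_cast
      rw [add_div]
      linarith
  have val : ∀ i : Fin N, f i = (2 * ((i : ℕ) : ℝ) + 1) / (2 * N) := by
    intro i
    have a := key i 0 (by omega)
    have b := key (N - 1 - i) i (by omega)
    have c := (h1 _ (hf ⟨0, by omega⟩)).1
    have d := (h1 _ (hf ⟨i + (N - 1 - i), by omega⟩)).2
    have e : ((N - 1 - i : ℕ) : ℝ) = N - 1 - (i : ℕ) := by
      rw [Nat.cast_sub (by omega), Nat.cast_sub hN]; simp
    rw [e] at b
    simp only [zero_add, Fin.eta] at a b
    have e1 : (2 * ((i : ℕ) : ℝ) + 1) / (2 * N) = (i : ℕ) / N + 1 / (2 * N) := by field_simp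
    have e2 : ((N : ℝ) - 1 - (i : ℕ)) / N = 1 - (2 * ((i : ℕ) : ℝ) + 1) / (2 * N) - 1 / (2 * N) := by
      field_simp; ring
    apply le_antisymm <;> linarith
  ext x
  rw [Finset.mem_image]
  constructor
  · intro hx
    have : x ∈ Set.range f := by rw [Finset.range_orderEmbOfFin]; exact hx
    obtain ⟨i, rfl⟩ := this
    exact ⟨i, by simp, (val i).symm⟩
  · rintro ⟨k, hk, rfl⟩
    have := hf ⟨k, Finset.mem_range.1 hk⟩
    rwa [val] at this

lemma q_const (N : ℕ) (hN : 1 ≤ N) (p : ℝ) (hp : 1 ≤ p) :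
    (1 / (2 * N : ℝ)) ^ p - N * (2 * (1 / (2 * N : ℝ)) ^ (p + 1) * (p / (p + 1)))
      = (1 / (2 * N : ℝ)) ^ p / (p + 1) := by
  have hN0 : (0:ℝ) < N := by exact_mod_cast hN
  rw [Real.rpow_add_one' (by positivity) (by linarith)]
  have : p + 1 ≠ 0 := by linarith
  field_simp
  ring

lemma q_wsum (ν : Measure ℝ) [IsProbabilityMeasure ν] (s : Finset ℝ)
    (hs : ν ((s : Set ℝ)ᶜ) = 0) : ∑ y ∈ s, ν.real {y} = 1 := by
  have := (q_int ν s hs (fun _ => 1)).2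
  simpa using this.symm

lemma q_G_le (p a : ℝ → ℝ) (s : Finset ℝ) (x y : ℝ) (hy : y ∈ s) :
    qg (p y) (a y) y x ≤ ∑ z ∈ s, qg (p z) (a z) z x :=
  Finset.single_le_sum (f := fun z => qg (p z) (a z) z x) (fun _ _ => qg_nonneg _ _ _ _) hy

lemma q_pt (p a y x : ℝ) : a ^ p - qg p a y x ≤ |y - x| ^ p := by
  have : a ^ p - |x - y| ^ p ≤ qg p a y x := le_max_left _ _
  rw [abs_sub_comm]
  linarith

lemma q_low (p : ℝ) (hp : 1 ≤ p) (ν : Measure ℝ) [IsProbabilityMeasure ν] (s : Finset ℝ)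
    (hs : ν ((s : Set ℝ)ᶜ) = 0) (a : ℝ → ℝ) :
    ∑ y ∈ s, ν.real {y} * a y ^ p - ∑ y ∈ s, ∫ x in Icc (0:ℝ) 1, qg p (a y) y x
      ≤ WpPow p (volume.restrict (Icc (0:ℝ) 1)) ν := by
  have := q_dual p hp ν s hs (fun y => a y ^ p) (fun x => ∑ y ∈ s, qg p (a y) y x)
    (continuous_finsetSum _ fun y _ => qg_cont p hp _ _) (fun x y hy => by
      have h1 := q_G_le (fun _ => p) a s x y hy
      have h2 := q_pt p (a y) y x
      linarith)
  rwa [integral_finsetSum _ fun y _ => (qg_cont p hp _ _).integrableOn_Icc] at this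

lemma q_lower (N : ℕ) (hN : 1 ≤ N) (p : ℝ) (hp : 1 ≤ p) (ν : Measure ℝ)
    [IsProbabilityMeasure ν] (hν : SuppLE N ν) :
    (1 / (2 * N : ℝ)) ^ p / (p + 1) ≤ WpPow p (volume.restrict (Icc (0:ℝ) 1)) ν := by
  obtain ⟨s, hc, hs⟩ := hν
  have h := q_low p hp ν s hs (fun _ => 1 / (2 * N : ℝ))
  rw [← Finset.sum_mul, q_wsum ν s hs, one_mul] at h
  rw [← q_const N hN p hp]
  have hK : 0 ≤ 2 * (1 / (2 * N : ℝ)) ^ (p + 1) * (p / (p + 1)) := by positivity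
  have h2 := Finset.sum_le_card_nsmul s _ _
    (fun y _ => qg_integral_le p hp (1 / (2 * N : ℝ)) y (by positivity))
  rw [nsmul_eq_mul] at h2
  have h3 := mul_le_mul_of_nonneg_right (show (s.card : ℝ) ≤ N by exact_mod_cast hc) hK
  linarith

lemma q_tangent (p : ℝ) (hp : 1 ≤ p) (h a : ℝ) (hh : 0 < h) (ha : 0 ≤ a) :
    h ^ (p + 1) + (p + 1) * h ^ p * (a - h) ≤ a ^ (p + 1) ∧
    (a ≠ h → h ^ (p + 1) + (p + 1) * h ^ p * (a - h) < a ^ (p + 1)) := by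
  by_cases e : a = h
  · subst e; simp
  have : h ^ (p + 1) + (p + 1) * h ^ p * (a - h) < a ^ (p + 1) := by
    have b := one_add_mul_self_lt_rpow_one_add (s := a / h - 1) (p := p + 1)
      (by have : 0 ≤ a / h := by positivity
          linarith) (by rw [sub_ne_zero]; intro h'; exact e ((div_eq_one_iff_eq hh.ne').1 h'))
      (by linarith)
    rw [show 1 + (a / h - 1) = a / h by ring, Real.div_rpow ha hh.le,
      lt_div_iff₀ (by positivity)] at b
    refine lt_of_eq_of_lt ?_ b
    rw [Real.rpow_add_one hh.ne']
    field_simp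
  exact ⟨this.le, fun _ => this⟩

lemma q_unique (N : ℕ) (hN : 1 ≤ N) (p : ℝ) (hp : 1 ≤ p) (ν : Measure ℝ)
    [IsProbabilityMeasure ν] (hν : SuppLE N ν)
    (hW : WpPow p (volume.restrict (Icc (0:ℝ) 1)) ν ≤ (1 / (2 * N : ℝ)) ^ p / (p + 1)) :
    ν = unifPrimalQuant N := by
  obtain ⟨s, hc, hs⟩ := hν
  have hN0 : (0:ℝ) < N := by exact_mod_cast hN
  have hC := q_const N hN p hp
  have h2N : 1 / (N:ℝ) = 2 * (1 / (2 * N : ℝ)) := by field_simp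
  set h : ℝ := 1 / (2 * N : ℝ) with hh
  have hpos : 0 < h := by positivity
  have hNh : N * h = 1 / 2 := by rw [hh]; field_simp
  set K : ℝ := 2 * h ^ (p + 1) * (p / (p + 1)) with hKdef
  have hK : 0 < K := by positivity
  have hle : ∀ y ∈ s, ∫ x in Icc (0:ℝ) 1, qg p h y x ≤ K :=
    fun y _ => qg_integral_le p hp h y hpos.le
  have hl := q_low p hp ν s hs (fun _ => h)
  rw [← Finset.sum_mul, q_wsum ν s hs, one_mul] at hl
  have hsum : (N:ℝ) * K ≤ ∑ y ∈ s, ∫ x in Icc (0:ℝ) 1, qg p h y x := by linarith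
  -- cardinality
  have hcard : s.card = N := by
    apply le_antisymm hc
    have h2 := Finset.sum_le_card_nsmul s _ _ hle
    rw [nsmul_eq_mul] at h2
    have : (N:ℝ) ≤ s.card := le_of_mul_le_mul_right (hsum.trans h2) hK
    exact_mod_cast this
  have hsumK : ∑ y ∈ s, K = N * K := by rw [Finset.sum_const, nsmul_eq_mul, hcard]
  have heq : ∀ y ∈ s, ∫ x in Icc (0:ℝ) 1, qg p h y x = K := by
    apply (Finset.sum_eq_sum_iff_of_le hle).1
    apply le_antisymm (Finset.sum_le_sum hle)
    linarith
  -- balls are contained in the unit interval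
  have hball : ∀ y ∈ s, ∀ x, x ∉ Icc (0:ℝ) 1 → h ≤ |x - y| := by
    intro y hy x hx
    have i1 := qg_integrable p hp h y hpos.le
    have e1 := integral_add_compl (measurableSet_Icc (a := (0:ℝ)) (b := 1)) i1
    rw [heq y hy, qg_integral p hp h y hpos.le] at e1
    have e2 : ∫ x in (Icc (0:ℝ) 1)ᶜ, qg p h y x = 0 := by linarith
    rw [setIntegral_eq_zero_iff_of_nonneg_ae
      (Filter.Eventually.of_forall (qg_nonneg p h y)) i1.integrableOn] at e2
    have e3 := Measure.eqOn_open_of_ae_eq e2 isClosed_Icc.isOpen_compl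
      (qg_cont p hp h y).continuousOn continuousOn_const hx
    by_contra hlt
    have := qg_pos p hp h y x (not_le.1 hlt)
    rw [e3] at this
    exact lt_irrefl _ this
  have hbox : ∀ y ∈ s, h ≤ y ∧ y ≤ 1 - h := by
    intro y hy
    have hy01 : y ∈ Icc (0:ℝ) 1 := by
      by_contra hn
      have := hball y hy y hn
      simp at this; linarith
    constructor
    · by_contra hlt
      push Not at hlt
      have := hball y hy ((y - h) / 2) (fun hx => by linarith [hx.1])
      rw [abs_of_neg (by linarith [hy01.1])] at this
      linarith
    · by_contra hlt
      push Not at hlt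
      have := hball y hy ((y + h + 1) / 2) (fun hx => by linarith [hx.2])
      rw [abs_of_pos (by linarith [hy01.2])] at this
      linarith [hy01.2]
  -- balls are disjoint
  have hsep : ∀ y ∈ s, ∀ z ∈ s, y < z → 1 / (N : ℝ) ≤ z - y := by
    intro y hy z hz hyz
    have cm : Continuous (fun x => min (qg p h y x) (qg p h z x)) :=
      (qg_cont p hp h y).min (qg_cont p hp h z)
    have cs : Continuous (fun x => ∑ y ∈ s, qg p h y x) :=
      continuous_finsetSum _ fun y _ => qg_cont p hp _ _
    have hd := q_dual p hp ν s hs (fun _ => h ^ p)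
      (fun x => ∑ y ∈ s, qg p h y x - min (qg p h y x) (qg p h z x)) (cs.sub cm) (by
        intro x w hw
        have hpt := q_pt p h w x
        have : qg p h w x + min (qg p h y x) (qg p h z x) ≤ ∑ y ∈ s, qg p h y x := by
          have hex : ∃ v ∈ s, v ≠ w ∧ min (qg p h y x) (qg p h z x) ≤ qg p h v x := by
            by_cases e : y = w
            · exact ⟨z, hz, by rw [← e]; exact hyz.ne', min_le_right _ _⟩
            · exact ⟨y, hy, e, min_le_left _ _⟩
          obtain ⟨v, hv, hvw, hm⟩ := hex
          rw [← Finset.add_sum_erase s _ hw]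
          have := Finset.single_le_sum (f := fun v => qg p h v x) (s := s.erase w)
            (fun _ _ => qg_nonneg _ _ _ _) (Finset.mem_erase.2 ⟨hvw, hv⟩)
          linarith
        linarith)
    rw [← Finset.sum_mul, q_wsum ν s hs, one_mul,
      integral_sub cs.integrableOn_Icc cm.integrableOn_Icc,
      integral_finsetSum _ fun y _ => (qg_cont p hp _ _).integrableOn_Icc,
      Finset.sum_congr rfl heq, hsumK] at hd
    have nn : ∀ x, 0 ≤ min (qg p h y x) (qg p h z x) :=
      fun x => le_min (qg_nonneg _ _ _ _) (qg_nonneg _ _ _ _)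
    have e2 : ∫ x in Icc (0:ℝ) 1, min (qg p h y x) (qg p h z x) = 0 := by
      apply le_antisymm (by linarith)
      exact integral_nonneg nn
    rw [setIntegral_eq_zero_iff_of_nonneg_ae
      (Filter.Eventually.of_forall nn) cm.integrableOn_Icc] at e2
    have hy1 := hbox y hy
    have hz1 := hbox z hz
    have e3 := Measure.eqOn_Icc_of_ae_eq volume zero_ne_one e2 cm.continuousOn continuousOn_const
      (show (y + z) / 2 ∈ Icc (0:ℝ) 1 from ⟨by linarith, by linarith⟩)
    by_contra hlt
    push Not at hlt
    rw [h2N] at hlt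
    have p1 := qg_pos p hp h y ((y + z) / 2) (by rw [abs_of_pos (by linarith)]; linarith)
    have p2 := qg_pos p hp h z ((y + z) / 2) (by rw [abs_of_neg (by linarith)]; linarith)
    have := lt_min p1 p2
    simp only [Pi.zero_apply] at e3
    linarith
  have hgrid := q_grid N hN s hcard hbox hsep
  -- weights
  have hw : ∀ y ∈ s, ν.real {y} / 2 = h := by
    have hl2 := q_low p hp ν s hs (fun y => ν.real {y} / 2)
    have t1 : ∑ y ∈ s, ∫ x in Icc (0:ℝ) 1, qg p (ν.real {y} / 2) y x
        ≤ ∑ y ∈ s, 2 * (ν.real {y} / 2) ^ (p + 1) * (p / (p + 1)) :=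
      Finset.sum_le_sum fun y _ => qg_integral_le p hp _ y (by positivity)
    have t2 : ∑ y ∈ s, ν.real {y} * (ν.real {y} / 2) ^ p
        = ∑ y ∈ s, 2 * (ν.real {y} / 2) ^ (p + 1) := by
      apply Finset.sum_congr rfl
      intro y _
      rw [Real.rpow_add_one' (by positivity) (by linarith)]
      ring
    rw [t2] at hl2
    have hp1 : p + 1 ≠ 0 := by linarith
    have t3 : ∑ y ∈ s, (ν.real {y} / 2) ^ (p + 1) ≤ h ^ p / 2 := by
      rw [← Finset.sum_mul, ← Finset.mul_sum] at t1
      rw [← Finset.mul_sum] at hl2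
      have : (2 / (p + 1)) * ∑ y ∈ s, (ν.real {y} / 2) ^ (p + 1) ≤ (2 / (p + 1)) * (h ^ p / 2) := by
        calc _ = 2 * ∑ y ∈ s, (ν.real {y} / 2) ^ (p + 1)
              - 2 * (∑ y ∈ s, (ν.real {y} / 2) ^ (p + 1)) * (p / (p + 1)) := by field_simp; ring
          _ ≤ h ^ p / (p + 1) := by linarith
          _ = _ := by field_simp
      exact le_of_mul_le_mul_left this (by positivity)
    have t4 : ∑ y ∈ s, (h ^ (p + 1) + (p + 1) * h ^ p * (ν.real {y} / 2 - h)) = h ^ p / 2 := by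
      rw [Finset.sum_add_distrib, ← Finset.mul_sum, Finset.sum_sub_distrib, ← Finset.sum_div,
        q_wsum ν s hs, Finset.sum_const, Finset.sum_const, hcard, nsmul_eq_mul, nsmul_eq_mul, hNh,
        Real.rpow_add_one hpos.ne']
      linear_combination h ^ p * hNh
    have hle2 : ∀ y ∈ s, h ^ (p + 1) + (p + 1) * h ^ p * (ν.real {y} / 2 - h)
        ≤ (ν.real {y} / 2) ^ (p + 1) :=
      fun y _ => (q_tangent p hp h (ν.real {y} / 2) hpos (by positivity)).1
    have t5 := (Finset.sum_eq_sum_iff_of_le hle2).1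
      (le_antisymm (Finset.sum_le_sum hle2) (by rw [t4]; exact t3))
    intro y hy
    by_contra hne
    exact absurd (t5 y hy)
      ((q_tangent p hp h (ν.real {y} / 2) hpos (by positivity)).2 hne).ne
  rw [q_meas_eq ν s hs, unifPrimalQuant, Finset.smul_sum]
  have hw2 : ∀ y ∈ s, ν {y} = (N : ENNReal)⁻¹ := by
    intro y hy
    have e : ν.real {y} = (N:ℝ)⁻¹ := by
      have := hw y hy
      rw [← one_div, h2N]; linarith
    rw [← ENNReal.ofReal_toReal (measure_ne_top ν {y})]
    change ENNReal.ofReal (ν.real {y}) = _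
    rw [e, ENNReal.ofReal_inv_of_pos hN0, ENNReal.ofReal_natCast]
  rw [Finset.sum_congr rfl fun y hy => by rw [hw2 y hy], hgrid, Finset.sum_image]
  intro i _ j _ hij
  simp only at hij
  field_simp at hij
  have : (i:ℝ) = j := by linarith
  exact_mod_cast this

lemma q_supp (N : ℕ) : SuppLE N (unifPrimalQuant N) := by
  refine ⟨(Finset.range N).image (fun k : ℕ => (2 * (k : ℝ) + 1) / (2 * N)),
    Finset.card_image_le.trans (by simp), ?_⟩
  rw [unifPrimalQuant, Measure.smul_apply, Measure.finsetSum_apply, Finset.sum_eq_zero]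
  · simp
  · intro k hk
    rw [Measure.dirac_apply' _ (Finset.measurableSet _).compl, indicator_of_notMem]
    intro h
    apply h
    exact Finset.mem_coe.2 (Finset.mem_image_of_mem _ hk)

lemma q_isprob (N : ℕ) (hN : 1 ≤ N) : IsProbabilityMeasure (unifPrimalQuant N) := by
  constructor
  rw [unifPrimalQuant, Measure.smul_apply, Measure.finsetSum_apply]
  simp only [measure_univ, Finset.sum_const, Finset.card_range, nsmul_eq_mul, mul_one, smul_eq_mul]
  exact ENNReal.inv_mul_cancel (by simp; omega) (by simp)

lemma q_root (N : ℕ) (hN : 1 ≤ N) (p : ℝ) (hp : 1 ≤ p) :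
    ((1 / (2 * N : ℝ)) ^ p / (p + 1)) ^ (1 / p) = 1 / (2 * (p + 1) ^ (1 / p) * N) := by
  rw [Real.div_rpow (by positivity) (by positivity), ← Real.rpow_mul (by positivity),
    mul_one_div_cancel (by linarith), Real.rpow_one]
  field_simp

theorem stmt14 (N : ℕ) (hN : 1 ≤ N) (p : ℝ) (hp : 1 ≤ p) :
    Wp p (volume.restrict (Icc (0:ℝ) 1)) (unifPrimalQuant N)
        = 1 / (2 * (p + 1) ^ (1 / p) * N) ∧
      sInf {c | ∃ ν : Measure ℝ, IsProbabilityMeasure ν ∧ SuppLE N ν ∧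
          c = Wp p (volume.restrict (Icc (0:ℝ) 1)) ν}
        = 1 / (2 * (p + 1) ^ (1 / p) * N) ∧
      (∀ ν : Measure ℝ, IsProbabilityMeasure ν → SuppLE N ν →
        1 / (2 * (p + 1) ^ (1 / p) * N) ≤ Wp p (volume.restrict (Icc (0:ℝ) 1)) ν) ∧
      (∀ ν : Measure ℝ, IsProbabilityMeasure ν → SuppLE N ν →
        Wp p (volume.restrict (Icc (0:ℝ) 1)) ν = 1 / (2 * (p + 1) ^ (1 / p) * N) →
        ν = unifPrimalQuant N) := by
  have := q_isprob N hN
  have hlow : ∀ ν : Measure ℝ, IsProbabilityMeasure ν → SuppLE N ν →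
        1 / (2 * (p + 1) ^ (1 / p) * N) ≤ Wp p (volume.restrict (Icc (0:ℝ) 1)) ν := by
    intro ν _ hs
    rw [← q_root N hN p hp]
    exact Real.rpow_le_rpow (by positivity) (q_lower N hN p hp ν hs) (by positivity)
  have heq : Wp p (volume.restrict (Icc (0:ℝ) 1)) (unifPrimalQuant N)
        = 1 / (2 * (p + 1) ^ (1 / p) * N) := by
    rw [← q_root N hN p hp, Wp]
    congr 1
    exact le_antisymm (q_upper N hN p hp) (q_lower N hN p hp _ (q_supp N))
  refine ⟨heq, ?_, hlow, ?_⟩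
  · apply IsLeast.csInf_eq
    refine ⟨⟨_, this, q_supp N, heq.symm⟩, ?_⟩
    rintro c ⟨ν, h1, h2, rfl⟩
    exact hlow ν h1 h2
  · intro ν _ hs he
    apply q_unique N hN p hp ν hs
    have hl := q_lower N hN p hp ν hs
    have h0 : (0:ℝ) ≤ (1 / (2 * N : ℝ)) ^ p / (p + 1) := by positivity
    rw [← q_root N hN p hp, Wp] at he
    exact ((Real.rpow_left_inj (h0.trans hl) h0 (by positivity)).1 he).le
end
end

section
/- Let μ be the uniform distribution on [0,1] and p ≥ 1, N ≥ 2. Then μ̌_N = (1/(2(N−1))) δ₀ + (1/(N−1)) Σ_{k=2}^{N−1} δ_{(k−1)/(N−1)} + (1/(2(N−1))) δ₁ is the unique W_p-projection of μ onto the set P_{≥μ}(ℝ,N) of measures supported on at most N points dominating μ in the convex order, and W_p(μ, P_{≥μ}(ℝ,N)) = 1/(2(p+1)^{1/p}(N−1)). -/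
open MeasureTheory Set

noncomputable section

variable {E : Type*} [NormedAddCommGroup E] [NormedSpace ℝ E] [MeasurableSpace E] [BorelSpace E]

/-- The optimal dual `N`-quantization of the uniform distribution on `[0,1]`. -/
def unifDualQuant (N : ℕ) : Measure ℝ :=
  (2 * ((N : ENNReal) - 1))⁻¹ • (Measure.dirac (0:ℝ) + Measure.dirac (1:ℝ)) +
    ((N : ENNReal) - 1)⁻¹ •
      ∑ k ∈ Finset.Icc 2 (N - 1), Measure.dirac (((k : ℝ) - 1) / ((N : ℝ) - 1))

/-- The bump function used in the dual lower bound. -/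
def psi (p c t : ℝ) : ℝ := max (c ^ p - |t| ^ p) 0

lemma psi_nonneg (p c t : ℝ) : 0 ≤ psi p c t := le_max_right _ _

lemma psi_even (p c t : ℝ) : psi p c (-t) = psi p c t := by simp [psi]

lemma psi_cont (p c : ℝ) (hp : 1 ≤ p) : Continuous (psi p c) := by
  unfold psi
  have : Continuous fun t : ℝ => |t| ^ p :=
    continuous_abs.rpow_const (fun _ => Or.inr (by linarith))
  fun_prop

lemma psi_zero_of (p c t : ℝ) (hp : 1 ≤ p) (hc : 0 < c) (ht : c ≤ |t|) : psi p c t = 0 := by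
  unfold psi
  apply max_eq_right
  have := Real.rpow_le_rpow hc.le ht (by linarith : 0 ≤ p)
  linarith

lemma psi_int (p c : ℝ) (hp : 1 ≤ p) (hc : 0 < c) : Integrable (psi p c) := by
  apply (psi_cont p c hp).integrable_of_hasCompactSupport
  apply HasCompactSupport.intro (isCompact_Icc (a := -c) (b := c))
  intro x hx
  apply psi_zero_of p c x hp hc
  by_contra h
  push Not at h
  rw [abs_lt] at h
  exact hx ⟨h.1.le, h.2.le⟩

/-- Half mass of `psi`. -/
def KK (p c : ℝ) : ℝ := c ^ p * c * p / (p + 1)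

lemma psi_half (p c : ℝ) (hp : 1 ≤ p) (hc : 0 < c) :
    ∫ x in Ioi (0:ℝ), psi p c x = KK p c := by
  have h1 : ∫ x in Ioi (0:ℝ), psi p c x = ∫ x in Ioc (0:ℝ) c, psi p c x := by
    apply setIntegral_eq_of_subset_of_forall_sdiff_eq_zero measurableSet_Ioi
    · intro x hx; exact hx.1
    · intro x hx
      apply psi_zero_of p c x hp hc
      by_contra h
      push Not at h
      rw [abs_lt] at h
      exact hx.2 ⟨hx.1, h.2.le⟩
  have h2 : ∫ x in Ioc (0:ℝ) c, psi p c x = ∫ x in Ioc (0:ℝ) c, (c ^ p - x ^ p) := by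
    apply setIntegral_congr_fun measurableSet_Ioc
    intro x hx
    simp only [psi]
    rw [abs_of_pos hx.1, max_eq_left]
    have := Real.rpow_le_rpow hx.1.le hx.2 (by linarith : 0 ≤ p)
    linarith
  rw [h1, h2, ← intervalIntegral.integral_of_le hc.le, intervalIntegral.integral_sub,
    integral_rpow (Or.inl (by linarith))]
  · simp only [intervalIntegral.integral_const, smul_eq_mul, KK]
    rw [Real.zero_rpow (by linarith), Real.rpow_add hc, Real.rpow_one]
    field_simp
    ring
  · simp
  · apply intervalIntegral.intervalIntegrable_rpow' (by linarith)

lemma KK_pos (p c : ℝ) (hp : 1 ≤ p) (hc : 0 < c) : 0 < KK p c := by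
  unfold KK; positivity

lemma psi_full (p c : ℝ) (hp : 1 ≤ p) (hc : 0 < c) : ∫ x, psi p c x = 2 * KK p c := by
  rw [← psi_half p c hp hc, ← integral_comp_abs]
  congr 1; ext x; simp [psi]

/-- Mass of the translated bump on the unit interval. -/
def II (p c z : ℝ) : ℝ := ∫ x in Icc (0:ℝ) 1, psi p c (x - z)

lemma II_le (p c z : ℝ) (hp : 1 ≤ p) (hc : 0 < c) : II p c z ≤ 2 * KK p c := by
  rw [← psi_full p c hp hc, ← integral_sub_right_eq_self (psi p c) z]
  exact setIntegral_le_integral ((psi_int p c hp hc).comp_sub_right z)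
    (Filter.Eventually.of_forall fun x => psi_nonneg _ _ _)

lemma II_le_left (p c z : ℝ) (hp : 1 ≤ p) (hc : 0 < c) (hz : z ≤ 0) :
    II p c z ≤ KK p c - ∫ x in (0:ℝ)..(-z), psi p c x := by
  have hint := psi_int p c hp hc
  have h1 : II p c z = ∫ x in (-z)..(1 - z), psi p c x := by
    rw [II, integral_Icc_eq_integral_Ioc, ← intervalIntegral.integral_of_le zero_le_one,
      intervalIntegral.integral_comp_sub_right, zero_sub]
  have h2 : (∫ x in (0:ℝ)..(-z), psi p c x) + ∫ x in (-z)..(1 - z), psi p c x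
      = ∫ x in (0:ℝ)..(1-z), psi p c x :=
    intervalIntegral.integral_add_adjacent_intervals hint.intervalIntegrable
      hint.intervalIntegrable
  have h3 : ∫ x in (0:ℝ)..(1-z), psi p c x ≤ KK p c := by
    rw [← psi_half p c hp hc, intervalIntegral.integral_of_le (by linarith)]
    apply setIntegral_mono_set hint.integrableOn
    · exact Filter.Eventually.of_forall fun x => psi_nonneg _ _ _
    · exact Filter.Eventually.of_forall fun x hx => hx.1
  linarith

lemma II_le_left' (p c z : ℝ) (hp : 1 ≤ p) (hc : 0 < c) (hz : z ≤ 0) : II p c z ≤ KK p c := by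
  have := II_le_left p c z hp hc hz
  have h2 : 0 ≤ ∫ x in (0:ℝ)..(-z), psi p c x :=
    intervalIntegral.integral_nonneg (by linarith) fun x _ => psi_nonneg _ _ _
  linarith

lemma II_lt_left (p c z : ℝ) (hp : 1 ≤ p) (hc : 0 < c) (hz : z < 0) : II p c z < KK p c := by
  have := II_le_left p c z hp hc hz.le
  have h2 : 0 < ∫ x in (0:ℝ)..(-z), psi p c x := by
    apply intervalIntegral.integral_pos (by linarith) (psi_cont p c hp).continuousOn
      fun x _ => psi_nonneg _ _ _
    refine ⟨0, ⟨le_rfl, by linarith⟩, ?_⟩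
    simp only [psi, abs_zero]
    rw [Real.zero_rpow (by linarith)]
    have := Real.rpow_pos_of_pos hc p
    simp [this]
  linarith

lemma II_symm (p c z : ℝ) : II p c (1 - z) = II p c z := by
  have h : ∀ w, II p c w = ∫ x in (0:ℝ)..1, psi p c (x - w) := by
    intro w
    rw [II, integral_Icc_eq_integral_Ioc, ← intervalIntegral.integral_of_le zero_le_one]
  rw [h, h]
  have := intervalIntegral.integral_comp_sub_left (a := 0) (b := 1) (fun x => psi p c (x - z)) 1
  rw [sub_self, sub_zero] at this
  rw [← this]
  congr 1; ext x
  rw [← psi_even]; congr 1; ring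

/-- Easy half of Kantorovich duality. -/
lemma dual_le (p : ℝ) (hp : 1 ≤ p) (ν : Measure ℝ) [IsProbabilityMeasure ν] (s : Finset ℝ)
    (hs : ν ((s : Set ℝ)ᶜ) = 0) (u v : ℝ → ℝ) (hu : Continuous u) (hv : Measurable v)
    (h : ∀ x ∈ Icc (0:ℝ) 1, ∀ y ∈ s, u x + v y ≤ |y - x| ^ p) :
    (∫ x in Icc (0:ℝ) 1, u x) + ∫ y, v y ∂ν ≤ WpPow p (volume.restrict (Icc (0:ℝ) 1)) ν := by
  have : IsProbabilityMeasure (volume.restrict (Icc (0:ℝ) 1)) := ⟨by simp⟩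
  apply le_csInf
  · refine ⟨_, (volume.restrict (Icc (0:ℝ) 1)).prod ν, inferInstance, ⟨?_, ?_⟩, rfl⟩
    · simp [Measure.map_fst_prod]
    · simp [Measure.map_snd_prod]
  · rintro _ ⟨π, hπ, ⟨h1, h2⟩, rfl⟩
    have e1 : ∫ x in Icc (0:ℝ) 1, u x = ∫ q, u q.1 ∂π := by
      rw [← h1, integral_map measurable_fst.aemeasurable hu.aestronglyMeasurable]
    have e2 : ∫ y, v y ∂ν = ∫ q, v q.2 ∂π := by
      rw [← h2, integral_map measurable_snd.aemeasurable hv.aestronglyMeasurable]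
    have a1 : ∀ᵐ q ∂π, q.1 ∈ Icc (0:ℝ) 1 := by
      apply ae_of_ae_map measurable_fst.aemeasurable (p := fun x => x ∈ Icc (0:ℝ) 1)
      rw [h1]; exact ae_restrict_mem measurableSet_Icc
    have a2 : ∀ᵐ q ∂π, q.2 ∈ s := by
      apply ae_of_ae_map measurable_snd.aemeasurable (p := fun x => x ∈ s)
      rw [h2]; exact hs
    have i1 : Integrable (fun q : ℝ × ℝ => u q.1) π := by
      have : Integrable u (π.map Prod.fst) := by
        rw [h1]; exact hu.continuousOn.integrableOn_compact isCompact_Icc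
      exact this.comp_measurable measurable_fst
    have i2 : Integrable (fun q : ℝ × ℝ => v q.2) π := by
      apply Integrable.of_bound (hv.comp measurable_snd).aestronglyMeasurable (∑ y ∈ s, ‖v y‖)
      filter_upwards [a2] with q hq
      exact Finset.single_le_sum (f := fun y => ‖v y‖) (fun i _ => norm_nonneg _) hq
    have i3 : Integrable (fun q : ℝ × ℝ => ‖q.2 - q.1‖ ^ p) π := by
      have hc : Continuous (fun q : ℝ × ℝ => ‖q.2 - q.1‖ ^ p) :=
        Continuous.rpow_const (by fun_prop) (fun _ => Or.inr (by linarith))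
      apply Integrable.of_bound hc.aestronglyMeasurable ((∑ y ∈ s, ‖y‖ + 1) ^ p)
      filter_upwards [a1, a2] with q hq1 hq2
      rw [Real.norm_of_nonneg (by positivity)]
      apply Real.rpow_le_rpow (norm_nonneg _) _ (by linarith)
      have := Finset.single_le_sum (f := fun y : ℝ => ‖y‖) (fun i _ => norm_nonneg _) hq2
      have h3 : ‖q.1‖ ≤ 1 := by
        rw [Real.norm_of_nonneg hq1.1]; exact hq1.2
      have := norm_sub_le q.2 q.1
      linarith
    rw [e1, e2, ← integral_add i1 i2]
    apply integral_mono_ae (i1.add i2) i3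
    filter_upwards [a1, a2] with q hq1 hq2
    exact h _ hq1 _ hq2

/-- The basic dual potential. -/
def FF (p c : ℝ) (s : Finset ℝ) (x : ℝ) : ℝ := c ^ p - ∑ z ∈ s, psi p c (x - z)

lemma FF_cont (p c : ℝ) (hp : 1 ≤ p) (s : Finset ℝ) : Continuous (FF p c s) := by
  have := psi_cont p c hp
  unfold FF
  fun_prop

lemma FF_le (p c : ℝ) (s : Finset ℝ) (x y : ℝ) (hy : y ∈ s) :
    FF p c s x + ∑ z ∈ s.erase y, psi p c (x - z) ≤ |y - x| ^ p := by
  unfold FF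
  rw [← Finset.add_sum_erase s _ hy, abs_sub_comm]
  have : c ^ p - |x - y| ^ p ≤ psi p c (x - y) := le_max_left _ _
  linarith

lemma FF_int (p c : ℝ) (hp : 1 ≤ p) (s : Finset ℝ) :
    ∫ x in Icc (0:ℝ) 1, FF p c s x = c ^ p - ∑ z ∈ s, II p c z := by
  have hps := psi_cont p c hp
  have hi : ∀ z ∈ s, Integrable (fun x => psi p c (x - z)) (volume.restrict (Icc (0:ℝ) 1)) := by
    intro z _
    exact Continuous.integrableOn_Icc (by fun_prop)
  unfold FF II
  rw [integral_sub (by simp) (integrable_finsetSum _ hi), integral_finsetSum _ hi]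
  simp

/-- The support straddles `[0,1]`. -/
lemma exists_le_zero (ν : Measure ℝ) [IsProbabilityMeasure ν] (s : Finset ℝ)
    (hs : ν ((s : Set ℝ)ᶜ) = 0) (hcv : ConvexOrder (volume.restrict (Icc (0:ℝ) 1)) ν) :
    ∃ a ∈ s, a ≤ 0 := by
  by_contra hcon
  push Not at hcon
  have hne : s.Nonempty := by
    rw [Finset.nonempty_iff_ne_empty]
    rintro rfl
    simp at hs
  set a := s.min' hne
  have ha : 0 < a := hcon _ (s.min'_mem hne)
  have hae : ∀ᵐ y ∂ν, y ∈ s := hs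
  have hz : ∀ᵐ y ∂ν, max (a - y) 0 = 0 := by
    filter_upwards [hae] with y hy
    exact max_eq_right (by linarith [s.min'_le y hy])
  have hc : Continuous fun y : ℝ => max (a - y) 0 := by fun_prop
  have h := hcv (fun y => max (a - y) 0) ?_ hc.integrableOn_Icc ?_
  · rw [integral_congr_ae hz, integral_Icc_eq_integral_Ioc,
      ← intervalIntegral.integral_of_le zero_le_one] at h
    have h2 : 0 < ∫ x in (0:ℝ)..1, max (a - x) 0 := by
      apply intervalIntegral.integral_pos (by norm_num) hc.continuousOn
        fun x _ => le_max_right _ _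
      exact ⟨0, ⟨le_rfl, zero_le_one⟩, by simp [ha]⟩
    simp at h
    linarith
  · apply ConvexOn.sup
    · exact (convexOn_const a convex_univ).sub (concaveOn_id convex_univ)
    · exact convexOn_const 0 convex_univ
  · exact (integrable_zero _ _ _).congr (by filter_upwards [hz] with y hy; exact hy.symm)

lemma exists_one_le (ν : Measure ℝ) [IsProbabilityMeasure ν] (s : Finset ℝ)
    (hs : ν ((s : Set ℝ)ᶜ) = 0) (hcv : ConvexOrder (volume.restrict (Icc (0:ℝ) 1)) ν) :
    ∃ a ∈ s, 1 ≤ a := by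
  by_contra hcon
  push Not at hcon
  have hne : s.Nonempty := by
    rw [Finset.nonempty_iff_ne_empty]
    rintro rfl
    simp at hs
  set a := s.max' hne
  have ha : a < 1 := hcon _ (s.max'_mem hne)
  have hae : ∀ᵐ y ∂ν, y ∈ s := hs
  have hz : ∀ᵐ y ∂ν, max (y - a) 0 = 0 := by
    filter_upwards [hae] with y hy
    exact max_eq_right (by linarith [s.le_max' y hy])
  have hc : Continuous fun y : ℝ => max (y - a) 0 := by fun_prop
  have h := hcv (fun y => max (y - a) 0) ?_ hc.integrableOn_Icc ?_
  · rw [integral_congr_ae hz, integral_Icc_eq_integral_Ioc,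
      ← intervalIntegral.integral_of_le zero_le_one] at h
    have h2 : 0 < ∫ x in (0:ℝ)..1, max (x - a) 0 := by
      apply intervalIntegral.integral_pos (by norm_num) hc.continuousOn
        fun x _ => le_max_right _ _
      exact ⟨1, ⟨zero_le_one, le_rfl⟩, by simp [ha]⟩
    simp at h
    linarith
  · apply ConvexOn.sup
    · exact (convexOn_id convex_univ).sub (concaveOn_const a convex_univ)
    · exact convexOn_const 0 convex_univ
  · exact (integrable_zero _ _ _).congr (by filter_upwards [hz] with y hy; exact hy.symm)

lemma sum_II_le (p c : ℝ) (hp : 1 ≤ p) (hc : 0 < c) (s : Finset ℝ)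
    (a b : ℝ) (has : a ∈ s) (hbs : b ∈ s) (ha : a ≤ 0) (hb : 1 ≤ b) :
    ∑ z ∈ s, II p c z ≤ II p c a + II p c b + 2 * KK p c * ((s.card : ℝ) - 2) := by
  have hab : b ∈ s.erase a := Finset.mem_erase.2 ⟨by linarith, hbs⟩
  rw [← Finset.add_sum_erase s _ has, ← Finset.add_sum_erase _ _ hab]
  have h1 : ∑ z ∈ (s.erase a).erase b, II p c z ≤ ((s.erase a).erase b).card • (2 * KK p c) :=
    Finset.sum_le_card_nsmul _ _ _ fun z _ => II_le p c z hp hc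
  have h2 : (((s.erase a).erase b).card : ℝ) = s.card - 2 := by
    have e1 := Finset.card_erase_add_one has
    have e2 := Finset.card_erase_add_one hab
    have : ((s.erase a).erase b).card + 2 = s.card := by omega
    rw [← this]; push_cast; ring
  rw [nsmul_eq_mul, h2] at h1
  linarith

lemma II_right' (p c z : ℝ) (hp : 1 ≤ p) (hc : 0 < c) (hz : 1 ≤ z) : II p c z ≤ KK p c := by
  rw [← II_symm]; exact II_le_left' p c _ hp hc (by linarith)

lemma II_right_lt (p c z : ℝ) (hp : 1 ≤ p) (hc : 0 < c) (hz : 1 < z) : II p c z < KK p c := by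
  rw [← II_symm]; exact II_lt_left p c _ hp hc (by linarith)

lemma sum_II_le2 (p c : ℝ) (hp : 1 ≤ p) (hc : 0 < c) (s : Finset ℝ) (n : ℕ)
    (hcard : s.card ≤ n + 1)
    (a b : ℝ) (has : a ∈ s) (hbs : b ∈ s) (ha : a ≤ 0) (hb : 1 ≤ b) :
    ∑ z ∈ s, II p c z ≤ 2 * n * KK p c := by
  have h := sum_II_le p c hp hc s a b has hbs ha hb
  have h1 := II_le_left' p c a hp hc ha
  have h2 := II_right' p c b hp hc hb
  have hK := KK_pos p c hp hc
  have : (s.card : ℝ) ≤ n + 1 := by exact_mod_cast hcard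
  nlinarith

lemma struct_eq (p c : ℝ) (hp : 1 ≤ p) (hc : 0 < c) (s : Finset ℝ) (n : ℕ)
    (hcard : s.card ≤ n + 1)
    (a b : ℝ) (has : a ∈ s) (hbs : b ∈ s) (ha : a ≤ 0) (hb : 1 ≤ b)
    (hge : 2 * n * KK p c ≤ ∑ z ∈ s, II p c z) :
    s.card = n + 1 ∧ ∀ z ∈ s, z ∈ Icc (0:ℝ) 1 := by
  have h1 := II_le_left' p c a hp hc ha
  have h2 := II_right' p c b hp hc hb
  have hK := KK_pos p c hp hc
  have hcr : (s.card : ℝ) ≤ n + 1 := by exact_mod_cast hcard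
  refine ⟨?_, ?_⟩
  · have h := sum_II_le p c hp hc s a b has hbs ha hb
    by_contra hne
    have : s.card + 1 ≤ n + 1 := by omega
    have : (s.card : ℝ) + 1 ≤ n + 1 := by exact_mod_cast this
    nlinarith
  · intro z hz
    constructor
    · by_contra hlt
      push Not at hlt
      have h := sum_II_le p c hp hc s z b hz hbs hlt.le hb
      have := II_lt_left p c z hp hc hlt
      nlinarith
    · by_contra hlt
      push Not at hlt
      have h := sum_II_le p c hp hc s a z has hz ha hlt.le
      have := II_right_lt p c z hp hc hlt
      nlinarith

lemma value_eq (p : ℝ) (hp : 1 ≤ p) (n : ℕ) (hn : 1 ≤ n) (c : ℝ) (hc : c = 1 / (2 * n)) :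
    c ^ p - 2 * n * KK p c = c ^ p / (p + 1) := by
  have hn' : (0:ℝ) < n := by exact_mod_cast hn
  have : 2 * (n:ℝ) * c = 1 := by rw [hc]; field_simp
  have h2 : 2 * n * KK p c = (2 * n * c) * (c ^ p * p / (p + 1)) := by unfold KK; ring
  rw [h2, this]
  field_simp
  ring

lemma int_FF_ge (p c : ℝ) (hp : 1 ≤ p) (n : ℕ) (hn : 1 ≤ n) (hc : c = 1 / (2 * n))
    (s : Finset ℝ) (hcard : s.card ≤ n + 1)
    (a b : ℝ) (has : a ∈ s) (hbs : b ∈ s) (ha : a ≤ 0) (hb : 1 ≤ b) :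
    c ^ p / (p + 1) ≤ ∫ x in Icc (0:ℝ) 1, FF p c s x := by
  have hn' : (0:ℝ) < n := by exact_mod_cast hn
  have hc0 : 0 < c := by rw [hc]; positivity
  rw [← value_eq p hp n hn c hc, FF_int p c hp]
  have := sum_II_le2 p c hp hc0 s n hcard a b has hbs ha hb
  linarith

lemma FF_le' (p c : ℝ) (s : Finset ℝ) (x y : ℝ) (hy : y ∈ s) :
    FF p c s x ≤ |y - x| ^ p := by
  have := FF_le p c s x y hy
  have h2 : 0 ≤ ∑ z ∈ s.erase y, psi p c (x - z) := Finset.sum_nonneg fun _ _ => psi_nonneg _ _ _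
  linarith

lemma FF_le_single (p c : ℝ) (s : Finset ℝ) (x y z : ℝ) (hy : y ∈ s) (hz : z ∈ s) (hzy : z ≠ y) :
    FF p c s x + psi p c (x - z) ≤ |y - x| ^ p := by
  have := FF_le p c s x y hy
  have h2 : psi p c (x - z) ≤ ∑ z ∈ s.erase y, psi p c (x - z) :=
    Finset.single_le_sum (f := fun z => psi p c (x - z)) (fun _ _ => psi_nonneg _ _ _)
      (Finset.mem_erase.2 ⟨hzy, hz⟩)
  linarith

lemma WpPow_ge_FF (p c : ℝ) (hp : 1 ≤ p) (ν : Measure ℝ) [IsProbabilityMeasure ν] (s : Finset ℝ)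
    (hs : ν ((s : Set ℝ)ᶜ) = 0) :
    ∫ x in Icc (0:ℝ) 1, FF p c s x ≤ WpPow p (volume.restrict (Icc (0:ℝ) 1)) ν := by
  have := dual_le p hp ν s hs (FF p c s) (fun _ => 0) (FF_cont p c hp s) measurable_const
    (fun x _ y hy => by simpa using FF_le' p c s x y hy)
  simpa using this

lemma psi_pos_of (p c t : ℝ) (hp : 1 ≤ p) (ht : |t| < c) : 0 < psi p c t := by
  unfold psi
  have := Real.rpow_lt_rpow (abs_nonneg t) ht (by linarith : 0 < p)
  exact lt_max_of_lt_left (by linarith)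

lemma separated (p c : ℝ) (hp : 1 ≤ p) (ν : Measure ℝ) [IsProbabilityMeasure ν]
    (s : Finset ℝ) (hs : ν ((s : Set ℝ)ᶜ) = 0)
    (hF : WpPow p (volume.restrict (Icc (0:ℝ) 1)) ν ≤ ∫ x in Icc (0:ℝ) 1, FF p c s x)
    (hI : ∀ z ∈ s, z ∈ Icc (0:ℝ) 1) (z w : ℝ) (hz : z ∈ s) (hw : w ∈ s) (hzw : z ≠ w) :
    2 * c ≤ |z - w| := by
  by_contra hlt
  push Not at hlt
  have hps := psi_cont p c hp
  have hFc := FF_cont p c hp s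
  have hr : Continuous fun x => min (psi p c (x - z)) (psi p c (x - w)) := by fun_prop
  have h := dual_le p hp ν s hs
    (fun x => FF p c s x + min (psi p c (x - z)) (psi p c (x - w))) (fun _ => 0)
    (by fun_prop) measurable_const ?_
  · rw [integral_add hFc.integrableOn_Icc hr.integrableOn_Icc] at h
    have h2 : 0 < ∫ x in Icc (0:ℝ) 1, min (psi p c (x - z)) (psi p c (x - w)) := by
      rw [integral_Icc_eq_integral_Ioc, ← intervalIntegral.integral_of_le zero_le_one]
      apply intervalIntegral.integral_pos (by norm_num) hr.continuousOn
        fun x _ => le_min (psi_nonneg _ _ _) (psi_nonneg _ _ _)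
      have h1 := hI z hz
      have h2 := hI w hw
      refine ⟨(z + w) / 2, ⟨by linarith [h1.1, h2.1], by linarith [h1.2, h2.2]⟩, ?_⟩
      rw [abs_lt] at hlt
      apply lt_min
      · apply psi_pos_of p c _ hp
        rw [abs_lt]; constructor <;> linarith
      · apply psi_pos_of p c _ hp
        rw [abs_lt]; constructor <;> linarith
    simp only [integral_zero] at h
    linarith
  · intro x _ y hy
    rcases eq_or_ne z y with rfl | hne
    · have := FF_le_single p c s x z w hy hw hzw.symm
      have := min_le_right (psi p c (x - z)) (psi p c (x - w))
      linarith
    · have := FF_le_single p c s x y z hy hz hne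
      have := min_le_left (psi p c (x - z)) (psi p c (x - w))
      linarith

lemma mass_r (p c : ℝ) (hp : 1 ≤ p) (ν : Measure ℝ) [IsProbabilityMeasure ν]
    (s : Finset ℝ) (hs : ν ((s : Set ℝ)ᶜ) = 0)
    (hF : WpPow p (volume.restrict (Icc (0:ℝ) 1)) ν ≤ ∫ x in Icc (0:ℝ) 1, FF p c s x)
    (z : ℝ) (hz : z ∈ s) (r lo hi : ℝ) (hr0 : 0 ≤ r) (hrc : r < c) (h0 : 0 ≤ lo) (h1 : hi ≤ 1)
    (hlh : lo ≤ hi) (hlo : z - r ≤ lo) (hhi : hi ≤ z + r) :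
    hi - lo ≤ ν.real {z} := by
  have hps := psi_cont p c hp
  have hFc := FF_cont p c hp s
  set ε := c ^ p - r ^ p with hε
  have hεp : 0 < ε := by
    have := Real.rpow_lt_rpow hr0 hrc (by linarith : 0 < p)
    linarith
  have hr : Continuous fun x => min (psi p c (x - z)) ε := by fun_prop
  have h := dual_le p hp ν s hs
    (fun x => FF p c s x + min (psi p c (x - z)) ε) (({z} : Set ℝ).indicator fun _ => -ε)
    (by fun_prop) (measurable_const.indicator (measurableSet_singleton z)) ?_
  · rw [integral_add hFc.integrableOn_Icc hr.integrableOn_Icc,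
      integral_indicator_const _ (measurableSet_singleton z), smul_eq_mul] at h
    have h2 : (hi - lo) * ε ≤ ∫ x in Icc (0:ℝ) 1, min (psi p c (x - z)) ε := by
      calc (hi - lo) * ε = ∫ x in Icc lo hi, ε := by
            simp [hlh]
        _ ≤ ∫ x in Icc lo hi, min (psi p c (x - z)) ε := by
            apply setIntegral_mono_on (by simp) hr.integrableOn_Icc measurableSet_Icc
            intro x hx
            apply le_min _ le_rfl
            refine le_trans ?_ (le_max_left _ _)
            have : |x - z| ≤ r := abs_le.2 ⟨by linarith [hx.1], by linarith [hx.2]⟩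
            have := Real.rpow_le_rpow (abs_nonneg _) this (by linarith : 0 ≤ p)
            linarith
        _ ≤ _ := by
            apply setIntegral_mono_set hr.integrableOn_Icc
            · exact Filter.Eventually.of_forall fun x => le_min (psi_nonneg _ _ _) hεp.le
            · exact (Icc_subset_Icc h0 h1).eventuallyLE
    have : (hi - lo) * ε ≤ ν.real {z} * ε := by linarith
    exact le_of_mul_le_mul_right this hεp
  · intro x _ y hy
    rcases eq_or_ne y z with rfl | hne
    · have := FF_le' p c s x y hy
      have := min_le_right (psi p c (x - y)) ε
      simp
      linarith
    · have := FF_le_single p c s x y z hy hz hne.symm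
      have := min_le_left (psi p c (x - z)) ε
      simp [hne]
      linarith

lemma mass (p c : ℝ) (hp : 1 ≤ p) (hc : 0 < c) (ν : Measure ℝ) [IsProbabilityMeasure ν]
    (s : Finset ℝ) (hs : ν ((s : Set ℝ)ᶜ) = 0)
    (hF : WpPow p (volume.restrict (Icc (0:ℝ) 1)) ν ≤ ∫ x in Icc (0:ℝ) 1, FF p c s x)
    (z : ℝ) (hz : z ∈ s) (lo hi : ℝ) (h0 : 0 ≤ lo) (h1 : hi ≤ 1)
    (hlz : lo ≤ z) (hzh : z ≤ hi) (hlo : z - c ≤ lo) (hhi : hi ≤ z + c) :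
    hi - lo ≤ ν.real {z} := by
  have key : ∀ θ : ℝ, 0 ≤ θ → θ < 1 → θ * (hi - lo) ≤ ν.real {z} := by
    intro θ h3 h4
    have := mass_r p c hp ν s hs hF z hz (θ * c) (z - θ * (z - lo)) (z + θ * (hi - z))
      (by positivity) (by nlinarith) (by nlinarith) (by nlinarith) (by nlinarith) (by nlinarith)
      (by nlinarith)
    linarith
  by_contra hlt
  push Not at hlt
  have hV : 0 ≤ ν.real {z} := measureReal_nonneg
  have hL : 0 < hi - lo := by linarith
  have := key ((ν.real {z} + (hi - lo)) / (2 * (hi - lo))) (by positivity)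
    (by rw [div_lt_one (by positivity)]; linarith)
  have h5 : (ν.real {z} + (hi - lo)) / (2 * (hi - lo)) * (hi - lo)
    = (ν.real {z} + (hi - lo)) / 2 := by field_simp
  linarith

lemma grid (n : ℕ) (hn : 1 ≤ n) (s : Finset ℝ) (hcard : s.card = n + 1)
    (hI : ∀ z ∈ s, z ∈ Icc (0:ℝ) 1)
    (hsep : ∀ z ∈ s, ∀ w ∈ s, z ≠ w → 1 ≤ |n * z - n * w|) (k : ℕ) (hk : k ≤ n) :
    (k : ℝ) / n ∈ s := by
  have hn' : (0:ℝ) < n := by exact_mod_cast hn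
  have hnn : ∀ z ∈ s, 0 ≤ n * z := fun z hz => mul_nonneg hn'.le (hI z hz).1
  have hle : ∀ z ∈ s, n * z ≤ n := fun z hz => by nlinarith [(hI z hz).2]
  have inj1 : Set.InjOn (fun z : ℝ => ⌊n * z⌋₊) s := by
    intro z hz w hw h
    by_contra hne
    have := hsep z hz w hw hne
    simp only at h
    have a1 := Nat.floor_le (hnn z hz)
    have a2 := Nat.lt_floor_add_one (n * z)
    have a3 := Nat.floor_le (hnn w hw)
    have a4 := Nat.lt_floor_add_one (n * w)
    rw [h] at a1 a2
    have : |n * z - n * w| < 1 := abs_lt.2 ⟨by linarith, by linarith⟩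
    linarith
  have inj2 : Set.InjOn (fun z : ℝ => ⌈n * z⌉₊) s := by
    intro z hz w hw h
    by_contra hne
    have := hsep z hz w hw hne
    simp only at h
    have a1 := Nat.le_ceil (n * z)
    have a2 := Nat.ceil_lt_add_one (hnn z hz)
    have a3 := Nat.le_ceil (n * w)
    have a4 := Nat.ceil_lt_add_one (hnn w hw)
    rw [h] at a1 a2
    have : |n * z - n * w| < 1 := abs_lt.2 ⟨by linarith, by linarith⟩
    linarith
  have im1 : s.image (fun z : ℝ => ⌊n * z⌋₊) = Finset.range (n + 1) := by
    apply Finset.eq_of_subset_of_card_le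
    · intro j hj
      obtain ⟨z, hz, rfl⟩ := Finset.mem_image.1 hj
      rw [Finset.mem_range, Nat.lt_succ_iff]
      exact Nat.floor_le_of_le (hle z hz)
    · rw [Finset.card_image_of_injOn inj1, hcard, Finset.card_range]
  have im2 : s.image (fun z : ℝ => ⌈n * z⌉₊) = Finset.range (n + 1) := by
    apply Finset.eq_of_subset_of_card_le
    · intro j hj
      obtain ⟨z, hz, rfl⟩ := Finset.mem_image.1 hj
      rw [Finset.mem_range, Nat.lt_succ_iff]
      exact Nat.ceil_le.2 (hle z hz)
    · rw [Finset.card_image_of_injOn inj2, hcard, Finset.card_range]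
  have hsum : ∑ z ∈ s, ⌊n * z⌋₊ = ∑ z ∈ s, ⌈n * z⌉₊ := by
    rw [← Finset.sum_image (f := fun j => j) inj1, ← Finset.sum_image (f := fun j => j) inj2,
      im1, im2]
  have heq := (Finset.sum_eq_sum_iff_of_le fun z _ => Nat.floor_le_ceil ((n:ℝ) * z)).1 hsum
  have hkm : k ∈ s.image (fun z : ℝ => ⌊n * z⌋₊) := by
    rw [im1, Finset.mem_range]; omega
  obtain ⟨z, hz, hzk⟩ := Finset.mem_image.1 hkm
  have e := heq z hz
  have a1 := Nat.floor_le (hnn z hz)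
  have a2 := Nat.le_ceil (n * z)
  rw [← e, hzk] at a2
  rw [hzk] at a1
  have : z = k / n := by
    rw [eq_div_iff hn'.ne']; linarith
  rwa [← this]

lemma hermite_hadamard (φ : ℝ → ℝ) (hφ : ConvexOn ℝ univ φ) (a b : ℝ) (hab : a < b)
    (hi : IntervalIntegrable φ volume a b) :
    ∫ x in a..b, φ x ≤ (b - a) / 2 * (φ a + φ b) := by
  have h1 : ∫ x in a..b, φ (a + b - x) = ∫ x in a..b, φ x := by
    rw [intervalIntegral.integral_comp_sub_left (fun x => φ x)]
    simp
  have hi2 : IntervalIntegrable (fun x => φ (a + b - x)) volume a b := by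
    have := (hi.comp_sub_left (a + b)).symm
    simpa using this
  have h2 : ∫ x in a..b, (φ x + φ (a + b - x)) ≤ ∫ x in a..b, (φ a + φ b) := by
    apply intervalIntegral.integral_mono_on hab.le (hi.add hi2) (by simp)
    intro x hx
    have hba : 0 < b - a := by linarith
    have t0 : 0 ≤ (b - x) / (b - a) := div_nonneg (by linarith [hx.2]) hba.le
    have t1 : 0 ≤ (x - a) / (b - a) := div_nonneg (by linarith [hx.1]) hba.le
    have ts : (b - x) / (b - a) + (x - a) / (b - a) = 1 := by field_simp; ring
    have ts' : (x - a) / (b - a) + (b - x) / (b - a) = 1 := by field_simp; ring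
    have c1 := hφ.2 (mem_univ a) (mem_univ b) t0 t1 ts
    have c2 := hφ.2 (mem_univ a) (mem_univ b) t1 t0 ts'
    simp only [smul_eq_mul] at c1 c2
    have e1 : (b - x) / (b - a) * a + (x - a) / (b - a) * b = x := by field_simp; ring
    have e2 : (x - a) / (b - a) * a + (b - x) / (b - a) * b = a + b - x := by field_simp; ring
    rw [e1] at c1
    rw [e2] at c2
    have : (b - x) / (b - a) = 1 - (x - a) / (b - a) := by linarith
    rw [this] at c1 c2
    nlinarith
  rw [intervalIntegral.integral_add hi hi2, h1] at h2
  simp only [intervalIntegral.integral_const, smul_eq_mul] at h2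
  linarith

lemma udq_eq (n : ℕ) (hn : 1 ≤ n) : unifDualQuant (n + 1) =
    ∑ k ∈ Finset.range n, ENNReal.ofReal (1 / (2 * n)) •
      (Measure.dirac ((k : ℝ) / n) + Measure.dirac (((k : ℝ) + 1) / n)) := by
  obtain ⟨m, rfl⟩ : ∃ m, n = m + 1 := ⟨n - 1, by omega⟩
  have hm : (0:ℝ) < (m + 1 : ℕ) := by positivity
  have e0 : (((m + 1 + 1 : ℕ) : ENNReal) - 1) = ((m + 1 : ℕ) : ENNReal) := by
    rw [Nat.cast_succ (m + 1)]
    exact ENNReal.add_sub_cancel_right (by simp)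
  have e1 : (2 * ((m + 1 : ℕ) : ENNReal))⁻¹ = ENNReal.ofReal (1 / (2 * (m + 1 : ℕ))) := by
    rw [one_div, ENNReal.ofReal_inv_of_pos (by positivity), ENNReal.ofReal_mul (by norm_num),
      ENNReal.ofReal_natCast]
    simp
  have e2 : ((m + 1 : ℕ) : ENNReal)⁻¹ = 2 * ENNReal.ofReal (1 / (2 * (m + 1 : ℕ))) := by
    have : (2:ENNReal) = ENNReal.ofReal 2 := by simp
    rw [this, ← ENNReal.ofReal_mul (by norm_num), ← ENNReal.ofReal_natCast,
      ← ENNReal.ofReal_inv_of_pos hm]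
    congr 1
    field_simp
  have e3 : ∑ k ∈ Finset.Icc 2 (m + 1 + 1 - 1),
      Measure.dirac (((k : ℝ) - 1) / (((m + 1 + 1 : ℕ) : ℝ) - 1))
      = ∑ k ∈ Finset.range m, Measure.dirac (((k : ℝ) + 1) / (m + 1 : ℕ)) := by
    have : Finset.Icc 2 (m + 1 + 1 - 1) = (Finset.range m).image (fun k => k + 2) := by
      ext j
      simp only [Finset.mem_Icc, Finset.mem_image, Finset.mem_range]
      constructor
      · intro h; exact ⟨j - 2, by omega, by omega⟩
      · rintro ⟨k, h, rfl⟩; omega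
    rw [this, Finset.sum_image (by intro a _ b _ h; simpa using h)]
    apply Finset.sum_congr rfl
    intro k _
    congr 1
    push_cast
    ring
  unfold unifDualQuant
  rw [e0, e3, e1, e2, ← Finset.smul_sum, Finset.sum_add_distrib,
    Finset.sum_range_succ' (fun k : ℕ => Measure.dirac ((k : ℝ) / ((m + 1 : ℕ) : ℝ))),
    Finset.sum_range_succ (fun k : ℕ => Measure.dirac (((k : ℝ) + 1) / ((m + 1 : ℕ) : ℝ)))]
  have e4 : ((m : ℝ) + 1) / ((m + 1 : ℕ) : ℝ) = 1 := by push_cast; field_simp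
  rw [e4, mul_comm, mul_smul, two_smul, smul_add]
  simp only [Nat.cast_zero, zero_div]
  simp only [smul_add]
  push_cast
  abel

lemma udq_prob (n : ℕ) (hn : 1 ≤ n) : IsProbabilityMeasure (unifDualQuant (n + 1)) := by
  rw [udq_eq n hn]
  constructor
  have hn' : (0:ℝ) < n := by exact_mod_cast hn
  simp only [Measure.finsetSum_apply, Measure.smul_apply, Measure.add_apply, measure_univ,
    smul_eq_mul, Finset.sum_const, Finset.card_range, nsmul_eq_mul]
  rw [← ENNReal.ofReal_natCast, one_add_one_eq_two]
  have : (2:ENNReal) = ENNReal.ofReal 2 := by simp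
  rw [this, ← ENNReal.ofReal_mul (by positivity), ← ENNReal.ofReal_mul (by positivity)]
  rw [← ENNReal.ofReal_one]
  congr 1
  field_simp

lemma udq_supp (n : ℕ) (hn : 1 ≤ n) : SuppLE (n + 1) (unifDualQuant (n + 1)) := by
  rw [udq_eq n hn]
  refine ⟨(Finset.range (n + 1)).image (fun k : ℕ => (k : ℝ) / n), ?_, ?_⟩
  · exact Finset.card_image_le.trans (by simp)
  · simp only [Measure.finsetSum_apply, Measure.smul_apply, Measure.add_apply,
      smul_eq_mul]
    apply Finset.sum_eq_zero
    intro k hk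
    rw [Finset.mem_range] at hk
    have hm : MeasurableSet ((((Finset.range (n + 1)).image (fun k : ℕ => (k : ℝ) / n) :
      Finset ℝ) : Set ℝ)ᶜ) := (Finset.measurableSet _).compl
    rw [Measure.dirac_apply' _ hm, Measure.dirac_apply' _ hm]
    rw [indicator_of_notMem, indicator_of_notMem]
    · simp
    · simp only [mem_compl_iff, not_not, Finset.mem_coe, Finset.mem_image, Finset.mem_range]
      exact ⟨k + 1, by omega, by push_cast; rfl⟩
    · simp only [mem_compl_iff, not_not, Finset.mem_coe, Finset.mem_image, Finset.mem_range]
      exact ⟨k, by omega, rfl⟩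

lemma udq_integral (n : ℕ) (hn : 1 ≤ n) (φ : ℝ → ℝ) : ∫ x, φ x ∂(unifDualQuant (n + 1)) =
    ∑ k ∈ Finset.range n, 1 / (2 * (n:ℝ)) * (φ ((k : ℝ) / n) + φ (((k : ℝ) + 1) / n)) := by
  have hd : ∀ a : ℝ, Integrable φ (Measure.dirac a) := fun a => integrable_dirac (by simp)
  rw [udq_eq n hn, integral_finsetSum_measure]
  · apply Finset.sum_congr rfl
    intro k _
    rw [integral_smul_measure, integral_add_measure (hd _) (hd _), integral_dirac, integral_dirac,
      ENNReal.toReal_ofReal (by positivity), smul_eq_mul]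
  · intro k _
    exact ((hd _).add_measure (hd _)).smul_measure ENNReal.ofReal_ne_top

lemma udq_convex (n : ℕ) (hn : 1 ≤ n) :
    ConvexOrder (volume.restrict (Icc (0:ℝ) 1)) (unifDualQuant (n + 1)) := by
  intro φ hφ hi _
  have hn' : (0:ℝ) < n := by exact_mod_cast hn
  have hII : ∀ k < n, IntervalIntegrable φ volume ((k : ℝ) / n) (((k + 1 : ℕ) : ℝ) / n) := by
    intro k hk
    have hk' : ((k + 1 : ℕ) : ℝ) ≤ n := by exact_mod_cast hk
    have hle : (k : ℝ) / n ≤ ((k + 1 : ℕ) : ℝ) / n := by gcongr; simp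
    rw [intervalIntegrable_iff_integrableOn_Icc_of_le hle]
    apply IntegrableOn.mono_set (t := Icc (0:ℝ) 1) hi
    apply Icc_subset_Icc
    · positivity
    · rw [div_le_one hn']; exact hk'
  rw [udq_integral n hn, integral_Icc_eq_integral_Ioc,
    ← intervalIntegral.integral_of_le zero_le_one]
  have hs := intervalIntegral.sum_integral_adjacent_intervals
    (a := fun k : ℕ => (k : ℝ) / n) (n := n) hII
  simp only [Nat.cast_zero, zero_div, div_self hn'.ne'] at hs
  rw [← hs]
  apply Finset.sum_le_sum
  intro k hk
  have := hermite_hadamard φ hφ ((k : ℝ) / n) (((k + 1 : ℕ) : ℝ) / n) (by gcongr; simp)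
    (hII k (Finset.mem_range.1 hk))
  refine this.trans (le_of_eq ?_)
  push_cast
  congr 1
  field_simp
  ring

lemma half_cost_left (p : ℝ) (hp : 1 ≤ p) (a c : ℝ) (hc : 0 < c) :
    ∫ x in Ioc a (a + c), ‖a - x‖ ^ p = c ^ p * c / (p + 1) := by
  rw [← intervalIntegral.integral_of_le (by linarith)]
  have h := intervalIntegral.integral_comp_sub_right (a := a) (b := a + c) (fun x => ‖x‖ ^ p) a
  have h2 : ∫ x in a..(a + c), ‖a - x‖ ^ p = ∫ x in a..(a + c), ‖x - a‖ ^ p := by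
    congr 1; ext x; rw [norm_sub_rev]
  rw [h2, h, sub_self, add_sub_cancel_left]
  have h3 : ∫ x in (0:ℝ)..c, ‖x‖ ^ p = ∫ x in (0:ℝ)..c, x ^ p := by
    apply intervalIntegral.integral_congr
    intro x hx
    rw [uIcc_of_le hc.le] at hx
    simp only
    rw [Real.norm_of_nonneg hx.1]
  rw [h3, integral_rpow (Or.inl (by linarith)), Real.zero_rpow (by linarith), Real.rpow_add hc,
    Real.rpow_one, sub_zero]

lemma half_cost_right (p : ℝ) (hp : 1 ≤ p) (b c : ℝ) (hc : 0 < c) :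
    ∫ x in Ioc (b - c) b, ‖b - x‖ ^ p = c ^ p * c / (p + 1) := by
  rw [← half_cost_left p hp (-b) c hc, ← intervalIntegral.integral_of_le (by linarith),
    ← intervalIntegral.integral_of_le (by linarith)]
  have := intervalIntegral.integral_comp_neg (a := b - c) (b := b) (fun x => ‖-b - x‖ ^ p)
  rw [show -b + c = -(b - c) by ring, ← this]
  congr 1; ext x
  rw [← norm_neg]; congr 2; ring

/-- Left half cell. -/
def cellA (n k : ℕ) : Measure ℝ :=
  volume.restrict (Ioc ((k : ℝ) / n) ((k : ℝ) / n + 1 / (2 * n)))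

/-- Right half cell. -/
def cellB (n k : ℕ) : Measure ℝ :=
  volume.restrict (Ioc (((k : ℝ) + 1) / n - 1 / (2 * n)) (((k : ℝ) + 1) / n))

/-- The nearest neighbour coupling. -/
def nnCoupling (n : ℕ) : Measure (ℝ × ℝ) :=
  ∑ k ∈ Finset.range n, ((cellA n k).map (fun x => (x, (k : ℝ) / n)) +
    (cellB n k).map (fun x => (x, ((k : ℝ) + 1) / n)))

lemma cell_add (n : ℕ) (hn : 1 ≤ n) (k : ℕ) : cellA n k + cellB n k =
    volume.restrict (Ioc ((k : ℝ) / n) (((k : ℝ) + 1) / n)) := by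
  have hn' : (0:ℝ) < n := by exact_mod_cast hn
  have e : ((k : ℝ) + 1) / n - 1 / (2 * n) = (k : ℝ) / n + 1 / (2 * n) := by field_simp; ring
  have e2 : ((k : ℝ) + 1) / n = (k : ℝ) / n + 1 / (2 * n) + 1 / (2 * n) := by field_simp; ring
  have hpos : 0 < 1 / (2 * (n:ℝ)) := by positivity
  unfold cellA cellB
  rw [e, ← Measure.restrict_union _ measurableSet_Ioc, Ioc_union_Ioc_eq_Ioc]
  · linarith
  · rw [e2]; linarith
  · rw [Set.disjoint_left]
    intro x hx hx2
    exact absurd hx2.1 (not_lt.2 hx.2)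

lemma cell_sum (n : ℕ) (hn : 1 ≤ n) (j : ℕ) : ∑ k ∈ Finset.range j, (cellA n k + cellB n k) =
    volume.restrict (Ioc (0:ℝ) ((j : ℝ) / n)) := by
  have hn' : (0:ℝ) < n := by exact_mod_cast hn
  induction j with
  | zero => simp
  | succ j ih =>
    rw [Finset.sum_range_succ, ih, cell_add n hn, ← Measure.restrict_union _ measurableSet_Ioc,
      Ioc_union_Ioc_eq_Ioc]
    · push_cast; rfl
    · positivity
    · gcongr; simp
    · rw [Set.disjoint_left]
      intro x hx hx2
      exact absurd hx2.1 (not_lt.2 hx.2)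

lemma map_fsum {α β : Type*} [MeasurableSpace α] [MeasurableSpace β] (s : Finset ℕ)
    (μ : ℕ → Measure α) (f : α → β) (hf : Measurable f) :
    (∑ k ∈ s, μ k).map f = ∑ k ∈ s, (μ k).map f := by
  induction s using Finset.induction_on with
  | empty => simp
  | insert a s ha ih => rw [Finset.sum_insert ha, Finset.sum_insert ha, Measure.map_add _ _ hf, ih]

lemma nn_fst (n : ℕ) (hn : 1 ≤ n) :
    (nnCoupling n).map Prod.fst = volume.restrict (Icc (0:ℝ) 1) := by
  have hn' : (0:ℝ) < n := by exact_mod_cast hn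
  have h := cell_sum n hn n
  rw [div_self hn'.ne', restrict_Ioc_eq_restrict_Icc] at h
  rw [← h, nnCoupling, map_fsum _ _ _ measurable_fst]
  apply Finset.sum_congr rfl
  intro k _
  rw [Measure.map_add _ _ measurable_fst, Measure.map_map measurable_fst (by fun_prop),
    Measure.map_map measurable_fst (by fun_prop)]
  congr 1
  · exact Measure.map_id
  · exact Measure.map_id

lemma nn_snd (n : ℕ) (hn : 1 ≤ n) :
    (nnCoupling n).map Prod.snd = unifDualQuant (n + 1) := by
  rw [udq_eq n hn, nnCoupling, map_fsum _ _ _ measurable_snd]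
  apply Finset.sum_congr rfl
  intro k _
  rw [Measure.map_add _ _ measurable_snd, Measure.map_map measurable_snd (by fun_prop),
    Measure.map_map measurable_snd (by fun_prop), smul_add]
  congr 1
  · change (cellA n k).map (fun _ => (k : ℝ) / n) = _
    rw [Measure.map_const, cellA]
    simp
  · change (cellB n k).map (fun _ => ((k : ℝ) + 1) / n) = _
    rw [Measure.map_const, cellB]
    simp

lemma nn_prob (n : ℕ) (hn : 1 ≤ n) : IsProbabilityMeasure (nnCoupling n) := by
  constructor
  have h := congrArg (fun m => m univ) (nn_fst n hn)
  simp only [Measure.map_apply measurable_fst MeasurableSet.univ, preimage_univ] at h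
  rw [h]; simp

lemma nn_cost (p : ℝ) (hp : 1 ≤ p) (n : ℕ) (hn : 1 ≤ n) :
    pCost p (nnCoupling n) = (1 / (2 * n)) ^ p / (p + 1) := by
  have hn' : (0:ℝ) < n := by exact_mod_cast hn
  have hpos : 0 < 1 / (2 * (n:ℝ)) := by positivity
  have hc : Continuous (fun q : ℝ × ℝ => ‖q.2 - q.1‖ ^ p) :=
    Continuous.rpow_const (by fun_prop) (fun _ => Or.inr (by linarith))
  have hc1 : ∀ a : ℝ, Continuous (fun x : ℝ => ‖a - x‖ ^ p) := fun a =>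
    Continuous.rpow_const (by fun_prop) (fun _ => Or.inr (by linarith))
  have iA : ∀ k, Integrable (fun q : ℝ × ℝ => ‖q.2 - q.1‖ ^ p)
      ((cellA n k).map (fun x => (x, (k : ℝ) / n))) := by
    intro k
    rw [integrable_map_measure hc.aestronglyMeasurable (by fun_prop)]
    exact (hc1 ((k : ℝ) / n)).integrableOn_Ioc
  have iB : ∀ k, Integrable (fun q : ℝ × ℝ => ‖q.2 - q.1‖ ^ p)
      ((cellB n k).map (fun x => (x, ((k : ℝ) + 1) / n))) := by
    intro k
    rw [integrable_map_measure hc.aestronglyMeasurable (by fun_prop)]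
    exact (hc1 (((k : ℝ) + 1) / n)).integrableOn_Ioc
  unfold pCost nnCoupling
  rw [integral_finsetSum_measure (fun k _ => (iA k).add_measure (iB k))]
  have : ∀ k ∈ Finset.range n, ∫ q, ‖q.2 - q.1‖ ^ p ∂((cellA n k).map (fun x => (x, (k : ℝ) / n)) +
    (cellB n k).map (fun x => (x, ((k : ℝ) + 1) / n)))
      = 2 * ((1 / (2 * (n:ℝ))) ^ p * (1 / (2 * n)) / (p + 1)) := by
    intro k _
    rw [integral_add_measure (iA k) (iB k), integral_map (by fun_prop) hc.aestronglyMeasurable,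
      integral_map (by fun_prop) hc.aestronglyMeasurable]
    simp only [cellA, cellB]
    rw [half_cost_left p hp _ _ hpos, half_cost_right p hp _ _ hpos]
    ring
  rw [Finset.sum_congr rfl this, Finset.sum_const, Finset.card_range, nsmul_eq_mul]
  generalize (1 / (2 * (n:ℝ))) ^ p = t
  field_simp

lemma udq_upper (p : ℝ) (hp : 1 ≤ p) (n : ℕ) (hn : 1 ≤ n) :
    WpPow p (volume.restrict (Icc (0:ℝ) 1)) (unifDualQuant (n + 1)) ≤
      (1 / (2 * n)) ^ p / (p + 1) := by
  apply csInf_le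
  · refine ⟨0, ?_⟩
    rintro _ ⟨π, _, _, rfl⟩
    exact integral_nonneg fun q => by positivity
  · exact ⟨nnCoupling n, nn_prob n hn, ⟨nn_fst n hn, nn_snd n hn⟩, (nn_cost p hp n hn).symm⟩

lemma lower (p : ℝ) (hp : 1 ≤ p) (n : ℕ) (hn : 1 ≤ n) (ν : Measure ℝ) [IsProbabilityMeasure ν]
    (hs : SuppLE (n + 1) ν) (hcv : ConvexOrder (volume.restrict (Icc (0:ℝ) 1)) ν) :
    (1 / (2 * n)) ^ p / (p + 1) ≤ WpPow p (volume.restrict (Icc (0:ℝ) 1)) ν := by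
  obtain ⟨s, hcard, hs⟩ := hs
  obtain ⟨a, has, ha⟩ := exists_le_zero ν s hs hcv
  obtain ⟨b, hbs, hb⟩ := exists_one_le ν s hs hcv
  exact (int_FF_ge p _ hp n hn rfl s hcard a b has hbs ha hb).trans (WpPow_ge_FF p _ hp ν s hs)

lemma unique (p : ℝ) (hp : 1 ≤ p) (n : ℕ) (hn : 1 ≤ n) (ν : Measure ℝ) [IsProbabilityMeasure ν]
    (hs : SuppLE (n + 1) ν) (hcv : ConvexOrder (volume.restrict (Icc (0:ℝ) 1)) ν)
    (heq : WpPow p (volume.restrict (Icc (0:ℝ) 1)) ν = (1 / (2 * n)) ^ p / (p + 1)) :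
    ν = unifDualQuant (n + 1) := by
  obtain ⟨s, hcard, hs⟩ := hs
  obtain ⟨a, has, ha⟩ := exists_le_zero ν s hs hcv
  obtain ⟨b, hbs, hb⟩ := exists_one_le ν s hs hcv
  have hn' : (0:ℝ) < n := by exact_mod_cast hn
  set c : ℝ := 1 / (2 * n) with hcdef
  have hc : 0 < c := by positivity
  have hge := int_FF_ge p _ hp n hn hcdef s hcard a b has hbs ha hb
  have hle := WpPow_ge_FF p c hp ν s hs
  have hF : WpPow p (volume.restrict (Icc (0:ℝ) 1)) ν ≤ ∫ x in Icc (0:ℝ) 1, FF p c s x := by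
    rw [heq]; exact hge
  obtain ⟨hcd, hI⟩ := struct_eq p c hp hc s n hcard a b has hbs ha hb (by
    rw [FF_int p c hp, heq, ← value_eq p hp n hn c hcdef] at hle
    linarith)
  have hg : ∀ k ≤ n, (k : ℝ) / n ∈ s := by
    intro k hk
    apply grid n hn s hcd hI _ k hk
    intro z hz w hw hzw
    have := separated p c hp ν s hs hF hI z w hz hw hzw
    rw [← mul_sub, abs_mul, abs_of_pos hn']
    calc (1:ℝ) = n * (2 * c) := by rw [hcdef]; field_simp
      _ ≤ _ := by gcongr
  have hc2 : (1:ℝ) / n = 2 * c := by rw [hcdef]; field_simp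
  obtain ⟨m, rfl⟩ : ∃ m, n = m + 1 := ⟨n - 1, by omega⟩
  have hm : ∀ k ≤ m + 1, ∀ lo hi : ℝ, 0 ≤ lo → hi ≤ 1 → lo ≤ (k : ℝ) / (m + 1 : ℕ) →
      (k : ℝ) / (m + 1 : ℕ) ≤ hi → (k : ℝ) / (m + 1 : ℕ) - c ≤ lo →
      hi ≤ (k : ℝ) / (m + 1 : ℕ) + c →
      ENNReal.ofReal (hi - lo) ≤ ν {(k : ℝ) / (m + 1 : ℕ)} := by
    intro k hk lo hi h0 h1 h2 h3 h4 h5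
    have := mass p c hp hc ν s hs hF _ (hg k hk) lo hi h0 h1 h2 h3 h4 h5
    rw [← ofReal_measureReal]
    exact ENNReal.ofReal_le_ofReal this
  have hc1 : c ≤ 1 := by
    rw [hcdef, div_le_one (by positivity)]
    have : (1:ℝ) ≤ (m + 1 : ℕ) := by exact_mod_cast hn
    linarith
  set g : ℕ → ENNReal := fun k => ν {(k : ℝ) / (m + 1 : ℕ)} with hgdef
  have g0 : ENNReal.ofReal c ≤ g 0 := by
    have := hm 0 (by omega) 0 c le_rfl hc1 (by simp) (by simp [hc.le]) (by simp [hc.le]) (by simp)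
    rwa [sub_zero] at this
  have g1 : ENNReal.ofReal c ≤ g (m + 1) := by
    have e : ((m + 1 : ℕ) : ℝ) / (m + 1 : ℕ) = 1 := div_self hn'.ne'
    have := hm (m + 1) le_rfl (1 - c) 1 (by linarith) le_rfl (by rw [e]; linarith) (by rw [e])
      (by rw [e]) (by rw [e]; linarith)
    rwa [sub_sub_cancel] at this
  have g2 : ∀ j < m, ENNReal.ofReal c + ENNReal.ofReal c ≤ g (j + 1) := by
    intro j hj
    have e1 : 2 * c ≤ ((j + 1 : ℕ) : ℝ) / (m + 1 : ℕ) := by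
      rw [← hc2]; gcongr; push_cast; linarith [(Nat.cast_nonneg j : (0:ℝ) ≤ j)]
    have e2 : ((j + 1 : ℕ) : ℝ) / (m + 1 : ℕ) + 2 * c ≤ 1 := by
      rw [← hc2, ← add_div, div_le_one hn']
      exact_mod_cast (by omega : j + 1 + 1 ≤ m + 1)
    have := hm (j + 1) (by omega) (((j + 1 : ℕ) : ℝ) / (m + 1 : ℕ) - c)
      (((j + 1 : ℕ) : ℝ) / (m + 1 : ℕ) + c) (by linarith) (by linarith) (by linarith) (by linarith)
      (by linarith) (by linarith)
    rw [← ENNReal.ofReal_add hc.le hc.le]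
    refine le_trans (le_of_eq ?_) this
    congr 1; ring
  have hprob := udq_prob (m + 1) hn
  symm
  apply Measure.eq_of_le_of_measure_univ_eq _ (by simp)
  rw [Measure.le_iff]
  intro A hA
  set f : ℕ → ENNReal := fun k => A.indicator 1 ((k : ℝ) / (m + 1 : ℕ)) with hf
  have hL : unifDualQuant (m + 1 + 1) A =
      ∑ k ∈ Finset.range (m + 1), ENNReal.ofReal c * (f k + f (k + 1)) := by
    rw [udq_eq (m + 1) hn]
    simp only [Measure.finsetSum_apply, Measure.smul_apply, Measure.add_apply,
      smul_eq_mul, Measure.dirac_apply' _ hA, hf, hcdef]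
    push_cast
    rfl
  have hR : ∑ k ∈ Finset.range (m + 2), g k * f k ≤ ν A := by
    have e : ∀ k ∈ Finset.range (m + 2), g k * f k = ν (A ∩ {(k : ℝ) / (m + 1 : ℕ)}) := by
      intro k _
      by_cases h : (k : ℝ) / (m + 1 : ℕ) ∈ A
      · rw [inter_eq_right.2 (singleton_subset_iff.2 h)]
        simp only [hgdef, hf]
        rw [indicator_of_mem h]; simp
      · rw [inter_singleton_eq_empty.2 h]
        simp only [hf]
        rw [indicator_of_notMem h]; simp
    rw [Finset.sum_congr rfl e, ← measure_biUnion_finset]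
    · exact measure_mono (iUnion₂_subset fun k _ => inter_subset_left)
    · intro i _ j _ hij
      apply Disjoint.mono inter_subset_right inter_subset_right
      rw [disjoint_singleton]
      intro h
      apply hij
      rw [div_left_inj' hn'.ne'] at h
      exact_mod_cast h
    · intro k _
      exact hA.inter (measurableSet_singleton _)
  refine le_trans ?_ hR
  have hL2 : ∑ k ∈ Finset.range (m + 1), ENNReal.ofReal c * (f k + f (k + 1)) =
      (∑ j ∈ Finset.range m, (ENNReal.ofReal c + ENNReal.ofReal c) * f (j + 1)
        + ENNReal.ofReal c * f 0) + ENNReal.ofReal c * f (m + 1) := by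
    simp only [mul_add, add_mul, Finset.sum_add_distrib]
    rw [Finset.sum_range_succ' (fun k => ENNReal.ofReal c * f k),
      Finset.sum_range_succ (fun k => ENNReal.ofReal c * f (k + 1))]
    abel
  rw [hL, hL2, Finset.sum_range_succ, Finset.sum_range_succ' (fun k => g k * f k)]
  gcongr with j hj
  exact g2 j (Finset.mem_range.1 hj)

lemma wp_conv (p : ℝ) (hp : 1 ≤ p) (n : ℕ) (hn : 1 ≤ n) :
    1 / (2 * (p + 1) ^ (1 / p) * (((n + 1 : ℕ) : ℝ) - 1)) =
      ((1 / (2 * n)) ^ p / (p + 1)) ^ (1 / p) := by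
  have hn' : (0:ℝ) < n := by exact_mod_cast hn
  rw [Real.div_rpow (by positivity) (by positivity), one_div p,
    Real.rpow_rpow_inv (by positivity) (by linarith)]
  push_cast
  rw [add_sub_cancel_right]
  field_simp

theorem stmt15 (N : ℕ) (hN : 2 ≤ N) (p : ℝ) (hp : 1 ≤ p) :
    IsProbabilityMeasure (unifDualQuant N) ∧ SuppLE N (unifDualQuant N) ∧
      ConvexOrder (volume.restrict (Icc (0:ℝ) 1)) (unifDualQuant N) ∧
      Wp p (volume.restrict (Icc (0:ℝ) 1)) (unifDualQuant N)
        = 1 / (2 * (p + 1) ^ (1 / p) * ((N : ℝ) - 1)) ∧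
      sInf {c | ∃ ν : Measure ℝ, IsProbabilityMeasure ν ∧ SuppLE N ν ∧
          ConvexOrder (volume.restrict (Icc (0:ℝ) 1)) ν ∧
          c = Wp p (volume.restrict (Icc (0:ℝ) 1)) ν}
        = 1 / (2 * (p + 1) ^ (1 / p) * ((N : ℝ) - 1)) ∧
      (∀ ν : Measure ℝ, IsProbabilityMeasure ν → SuppLE N ν →
        ConvexOrder (volume.restrict (Icc (0:ℝ) 1)) ν →
        1 / (2 * (p + 1) ^ (1 / p) * ((N : ℝ) - 1))
          ≤ Wp p (volume.restrict (Icc (0:ℝ) 1)) ν) ∧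
      (∀ ν : Measure ℝ, IsProbabilityMeasure ν → SuppLE N ν →
        ConvexOrder (volume.restrict (Icc (0:ℝ) 1)) ν →
        Wp p (volume.restrict (Icc (0:ℝ) 1)) ν
            = 1 / (2 * (p + 1) ^ (1 / p) * ((N : ℝ) - 1)) →
        ν = unifDualQuant N) := by

  obtain ⟨n, rfl⟩ : ∃ n, N = n + 1 := ⟨N - 1, by omega⟩
  have hn : 1 ≤ n := by omega
  have hprob := udq_prob n hn
  have hsupp := udq_supp n hn
  have hcvx := udq_convex n hn
  have hn' : (0:ℝ) < n := by exact_mod_cast hn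
  have hv : 0 ≤ (1 / (2 * (n:ℝ))) ^ p / (p + 1) := by positivity
  have hip : 0 < 1 / p := by positivity
  have hlow : ∀ ν : Measure ℝ, IsProbabilityMeasure ν → SuppLE (n + 1) ν →
        ConvexOrder (volume.restrict (Icc (0:ℝ) 1)) ν →
        1 / (2 * (p + 1) ^ (1 / p) * (((n + 1 : ℕ) : ℝ) - 1))
          ≤ Wp p (volume.restrict (Icc (0:ℝ) 1)) ν := by
    intro ν h1 h2 h3
    rw [wp_conv p hp n hn]
    exact Real.rpow_le_rpow hv (lower p hp n hn ν h2 h3) hip.le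
  have hW : Wp p (volume.restrict (Icc (0:ℝ) 1)) (unifDualQuant (n + 1))
        = 1 / (2 * (p + 1) ^ (1 / p) * (((n + 1 : ℕ) : ℝ) - 1)) := by
    rw [wp_conv p hp n hn, Wp]
    congr 1
    exact le_antisymm (udq_upper p hp n hn) (lower p hp n hn _ hsupp hcvx)
  refine ⟨hprob, hsupp, hcvx, hW, ?_, hlow, ?_⟩
  · apply IsLeast.csInf_eq
    refine ⟨⟨_, hprob, hsupp, hcvx, hW.symm⟩, ?_⟩
    rintro _ ⟨ν, h1, h2, h3, rfl⟩
    exact hlow ν h1 h2 h3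
  · intro ν h1 h2 h3 h4
    apply unique p hp n hn ν h2 h3
    rw [wp_conv p hp n hn, Wp] at h4
    exact (Real.rpow_left_inj (hv.trans (lower p hp n hn ν h2 h3)) hv hip.ne').1 h4
end
end
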